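/- arXiv:math/0308213 — 4 statements merged into one kernel-verified Lean document; each statement's English description precedes it below -/
import Mathlib

section
/- For infinitely many positive integers n there exists a totally positive algebraic integer of degree n over ℚ whose trace is less than 2n − (1/4)·(log log n)/(log log log n). -/
open Polynomial

/-- The multiset of Galois conjugates (in `ℂ`) of a real algebraic number:
the complex roots of its minimal polynomial over `ℚ`. -/
noncomputable def conjugatesC (θ : ℝ) : Multiset ℂ :=
  ((minpoly ℚ θ).map (algebraMap ℚ ℂ)).roots

/-- The trace of a real algebraic number: minus the coefficient of the
second-highest power of its monic minimal polynomial over `ℚ`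
(equivalently, the sum of its Galois conjugates). -/
noncomputable def traceQ (θ : ℝ) : ℚ :=
  -((minpoly ℚ θ).coeff ((minpoly ℚ θ).natDegree - 1))

/-- A totally positive algebraic integer: all its Galois conjugates are real and positive. -/
def IsTotallyPositiveAlgInt (θ : ℝ) : Prop :=
  IsIntegral ℤ θ ∧ ∀ z ∈ conjugatesC θ, z.im = 0 ∧ 0 < z.re

theorem exists_real_eq_of_alternating {n : ℕ} {Q : ℝ[X]} (hQ : Q.Monic) (hn : Q.natDegree = n)
    {ξ : Fin (n + 1) → ℝ} (hξ : StrictMono ξ)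
    (hs : ∀ i : Fin n, Q.eval (ξ i.castSucc) * Q.eval (ξ i.succ) < 0)
    {z : ℂ} (hz : aeval z Q = 0) : ∃ x : ℝ, ξ 0 < x ∧ (x : ℂ) = z := by
  have hroot (i : Fin n) : ∃ x, ξ i.castSucc < x ∧ x < ξ i.succ ∧ Q.eval x = 0 := by
    have hle : ξ i.castSucc ≤ ξ i.succ := (hξ i.castSucc_lt_succ).le
    have hc : ContinuousOn (fun x => Q.eval x) (Set.Icc (ξ i.castSucc) (ξ i.succ)) :=
      Q.continuous.continuousOn
    rcases mul_neg_iff.mp (hs i) with ⟨h₁, h₂⟩ | ⟨h₁, h₂⟩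
    · obtain ⟨x, ⟨hx₁, hx₂⟩, hx⟩ := intermediate_value_Ioo' hle hc ⟨h₂, h₁⟩
      exact ⟨x, hx₁, hx₂, hx⟩
    · obtain ⟨x, ⟨hx₁, hx₂⟩, hx⟩ := intermediate_value_Ioo hle hc ⟨h₁, h₂⟩
      exact ⟨x, hx₁, hx₂, hx⟩
  choose r hr₁ hr₂ hr using hroot
  have hmono : StrictMono r := fun i j hij =>
    (hr₂ i).trans_le ((hξ.monotone (Fin.succ_le_castSucc_iff.mpr hij)).trans (hr₁ j).le)
  have hle : (Finset.univ.image r).val ≤ Q.roots := by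
    refine Finset.val_le_iff_val_subset.mpr fun x hx => ?_
    obtain ⟨i, -, rfl⟩ := Finset.mem_image.mp (Finset.mem_val.mp hx)
    exact (mem_roots hQ.ne_zero).mpr (hr i)
  have hcard : (Finset.univ.image r).val.card = n := by
    rw [Finset.card_val, Finset.card_image_of_injective _ hmono.injective, Finset.card_fin]
  have heq : (Finset.univ.image r).val = Q.roots :=
    Multiset.eq_of_le_of_card_le hle (by rw [hcard, ← hn]; exact card_roots' Q)
  have hprod := prod_multiset_X_sub_C_of_monic_of_roots_card_eq hQ (by rw [← heq, hcard, hn])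
  rw [← hprod, map_multiset_prod, Multiset.prod_eq_zero_iff] at hz
  simp only [Multiset.mem_map, exists_exists_and_eq_and] at hz
  obtain ⟨x, hx, hxz⟩ := hz
  rw [← heq] at hx
  obtain ⟨i, -, rfl⟩ := Finset.mem_image.mp (Finset.mem_val.mp hx)
  refine ⟨r i, (hξ.monotone (Fin.zero_le _)).trans_lt (hr₁ i), ?_⟩
  simp only [map_sub, aeval_X, aeval_C, Complex.coe_algebraMap] at hxz
  exact (sub_eq_zero.mp hxz).symm

/-- The homogenized iterates of `t ↦ t ^ 2 - 2` evaluated at `P / D`. -/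
noncomputable def doublingTower (P D : ℤ[X]) : ℕ → ℤ[X]
  | 0 => P
  | j + 1 => doublingTower P D j ^ 2 - C 2 * D ^ 2 ^ (j + 1)

section doublingTower

variable {P D : ℤ[X]}

theorem doublingTower_roots_pos
    (h : ∀ c : ℝ, -2 ≤ c → c ≤ 2 → ∀ z : ℂ, aeval z P = c * aeval z D →
      ∃ x : ℝ, 0 < x ∧ (x : ℂ) = z) (j : ℕ) :
    ∀ c : ℝ, -2 ≤ c → c ≤ 2 → ∀ z : ℂ, aeval z (doublingTower P D j) = c * aeval z D ^ 2 ^ j →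
      ∃ x : ℝ, 0 < x ∧ (x : ℂ) = z := by
  induction j with
  | zero => simpa [doublingTower] using h
  | succ j ih =>
    intro c hc₁ hc₂ z hz
    have hs₂ : √(2 + c) ≤ 2 := Real.sqrt_le_iff.mpr ⟨by norm_num, by linarith⟩
    have hs₀ := Real.sqrt_nonneg (2 + c)
    have hsq : ((√(2 + c) : ℝ) : ℂ) ^ 2 = 2 + c := by
      exact_mod_cast Real.sq_sqrt (by linarith : 0 ≤ 2 + c)
    have hfac : (aeval z (doublingTower P D j) - (√(2 + c) : ℝ) * aeval z D ^ 2 ^ j) *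
        (aeval z (doublingTower P D j) - (-√(2 + c) : ℝ) * aeval z D ^ 2 ^ j) = 0 := by
      simp only [doublingTower, map_sub, map_mul, map_pow, aeval_C, pow_succ 2 j, pow_mul] at hz
      simp only [eq_intCast, Int.cast_ofNat] at hz
      push_cast
      linear_combination hz - (aeval z D ^ 2 ^ j) ^ 2 * hsq
    rcases mul_eq_zero.mp hfac with h₀ | h₀
    · exact ih _ (by linarith) hs₂ z (sub_eq_zero.mp h₀)
    · exact ih _ (by linarith) (by linarith) z (sub_eq_zero.mp h₀)

theorem doublingTower_monic_and_natDegree (hP : P.Monic) (hD : D.natDegree < P.natDegree) (j : ℕ) :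
    (doublingTower P D j).Monic ∧ (doublingTower P D j).natDegree = 2 ^ j * P.natDegree := by
  induction j with
  | zero => simpa [doublingTower] using hP
  | succ j ih =>
    obtain ⟨hm, hd⟩ := ih
    have hsq : (doublingTower P D j ^ 2).natDegree = 2 ^ (j + 1) * P.natDegree := by
      rw [hm.natDegree_pow, hd]; ring
    have hlt : (C 2 * D ^ 2 ^ (j + 1)).natDegree < (doublingTower P D j ^ 2).natDegree := by
      rw [hsq]
      refine (natDegree_C_mul_le _ _).trans_lt (natDegree_pow_le.trans_lt ?_)
      exact Nat.mul_lt_mul_of_pos_left hD (by positivity)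
    exact ⟨(hm.pow 2).sub_of_left (degree_lt_degree hlt),
      (natDegree_sub_eq_left_of_natDegree_lt hlt).trans hsq⟩

theorem doublingTower_nextCoeff (hP : P.Monic) (hD : D.natDegree < P.natDegree) (j : ℕ) :
    (doublingTower P D j).nextCoeff = 2 ^ j * P.nextCoeff := by
  induction j with
  | zero => simp [doublingTower]
  | succ j ih =>
    obtain ⟨hm, hd⟩ := doublingTower_monic_and_natDegree hP hD j
    have hd' := (doublingTower_monic_and_natDegree hP hD (j + 1)).2
    have hpos : 0 < P.natDegree := (Nat.zero_le _).trans_lt hD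
    have hsq : (doublingTower P D j ^ 2).natDegree = 2 ^ (j + 1) * P.natDegree := by
      rw [hm.natDegree_pow, hd]; ring
    have hnext := hm.nextCoeff_pow 2
    rw [nextCoeff_of_natDegree_pos (by rw [hsq]; positivity), hsq, ih] at hnext
    rw [nextCoeff_of_natDegree_pos (by rw [hd']; positivity), hd', doublingTower, coeff_sub, hnext,
      coeff_eq_zero_of_natDegree_lt (p := C 2 * D ^ 2 ^ (j + 1)), nsmul_eq_mul]
    · push_cast; ring
    · refine (natDegree_C_mul_le _ _).trans_lt (natDegree_pow_le.trans_lt ?_)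
      have h₁ : 2 ^ (j + 1) * (D.natDegree + 1) ≤ 2 ^ (j + 1) * P.natDegree :=
        Nat.mul_le_mul_left _ hD
      have h₂ : 2 ≤ 2 ^ (j + 1) := by
        rw [pow_succ]; exact Nat.le_mul_of_pos_left 2 (by positivity)
      rw [mul_add] at h₁
      omega

theorem doublingTower_map_zmod_two (j : ℕ) :
    (doublingTower P D j).map (algebraMap ℤ (ZMod 2)) =
      P.map (algebraMap ℤ (ZMod 2)) ^ 2 ^ j := by
  induction j with
  | zero => simp [doublingTower]
  | succ j ih =>
    have h2 : algebraMap ℤ (ZMod 2) 2 = 0 := by decide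
    rw [doublingTower, Polynomial.map_sub, Polynomial.map_pow, Polynomial.map_mul, map_C, h2, ih,
      C_0, zero_mul, sub_zero, pow_succ 2 j, pow_mul]

theorem doublingTower_succ_eq (j : ℕ) :
    ∃ A B : ℤ[X], doublingTower P D (j + 1) = P * A - C 2 * D ^ 2 ^ (j + 1) + C 4 * B := by
  have h4 : (C 4 : ℤ[X]) = C 2 * C 2 := by rw [← C_mul]; norm_num
  induction j with
  | zero => exact ⟨P, 0, by simp [doublingTower]; ring⟩
  | succ j ih =>
    obtain ⟨A, B, h⟩ := ih
    refine ⟨A * (P * A + 2 * (C 2 * (C 2 * B - D ^ 2 ^ (j + 1)))),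
      (C 2 * B - D ^ 2 ^ (j + 1)) ^ 2, ?_⟩
    rw [doublingTower, h, h4]
    ring

theorem mem_ker_algebraMap_zmod_two_sq {a : ℤ} :
    a ∈ RingHom.ker (algebraMap ℤ (ZMod 2)) ^ 2 ↔ 4 ∣ a := by
  rw [show algebraMap ℤ (ZMod 2) = Int.castRingHom (ZMod 2) from rfl, ZMod.ker_intCastRingHom,
    Ideal.span_singleton_pow, Ideal.mem_span_singleton]
  norm_num

theorem C_two_dvd_iff_map_eq_zero {f : ℤ[X]} :
    C 2 ∣ f ↔ f.map (algebraMap ℤ (ZMod 2)) = 0 := by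
  rw [C_dvd_iff_dvd_coeff, Polynomial.ext_iff]
  refine forall_congr' fun i => ?_
  rw [coeff_map, coeff_zero, eq_intCast]
  exact (ZMod.intCast_zmod_eq_zero_iff_dvd (f.coeff i) 2).symm

/-- Irreducibility of the positive levels of the tower, by the generalized Eisenstein criterion
at `2`. -/
theorem doublingTower_succ_irreducible (hP : P.Monic) (hD : D.natDegree < P.natDegree)
    (hirr : Irreducible (P.map (algebraMap ℤ (ZMod 2))))
    (hD2 : D.map (algebraMap ℤ (ZMod 2)) ≠ 0) (j : ℕ) :
    Irreducible (doublingTower P D (j + 1)) := by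
  obtain ⟨hm, hd⟩ := doublingTower_monic_and_natDegree hP hD (j + 1)
  have hpos : 0 < P.natDegree := (Nat.zero_le _).trans_lt hD
  refine generalizedEisenstein (K := ZMod 2) (q := P) (p := 2 ^ (j + 1)) hirr hP hm.isPrimitive
    (by rw [hd]; positivity) (by simp [hm.leadingCoeff])
    (by rw [hm.leadingCoeff, doublingTower_map_zmod_two]; simp) fun h0 => ?_
  have h4 : C 4 ∣ doublingTower P D (j + 1) %ₘ P := by
    refine (C_dvd_iff_dvd_coeff _ _).mpr fun i => ?_
    have := congrArg (fun f => f.coeff i) h0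
    simp only [coeff_map, coeff_zero, Ideal.Quotient.eq_zero_iff_mem] at this
    exact mem_ker_algebraMap_zmod_two_sq.mp this
  obtain ⟨E, hE⟩ := h4
  obtain ⟨A, B, hAB⟩ := doublingTower_succ_eq (P := P) (D := D) j
  have hdiv := modByMonic_add_div (doublingTower P D (j + 1)) P
  rw [hE, hAB] at hdiv
  set S := A - (P * A - C 2 * D ^ 2 ^ (j + 1) + C 4 * B) /ₘ P with hS
  have h44 : (C 4 : ℤ[X]) = C 2 * C 2 := by rw [← C_mul]; norm_num
  have hPS : P * S = C 2 * (D ^ 2 ^ (j + 1) + C 2 * (E - B)) := by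
    rw [hS]
    linear_combination (-1 : ℤ[X]) * hdiv + (E - B) * h44
  have hS2 : C 2 ∣ S := by
    rw [C_two_dvd_iff_map_eq_zero]
    have hmap : (P * S).map (algebraMap ℤ (ZMod 2)) = 0 :=
      C_two_dvd_iff_map_eq_zero.mp ⟨_, hPS⟩
    rw [Polynomial.map_mul] at hmap
    exact (mul_eq_zero.mp hmap).resolve_left hirr.ne_zero
  obtain ⟨T, hT⟩ := hS2
  have hPT : P * T = D ^ 2 ^ (j + 1) + C 2 * (E - B) := by
    refine mul_left_cancel₀ (C_ne_zero.mpr (two_ne_zero (α := ℤ))) ?_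
    rw [← hPS, hT]; ring
  have hdvd : P.map (algebraMap ℤ (ZMod 2)) ∣ D.map (algebraMap ℤ (ZMod 2)) := by
    refine hirr.prime.dvd_of_dvd_pow (n := 2 ^ (j + 1)) ⟨T.map (algebraMap ℤ (ZMod 2)), ?_⟩
    rw [← Polynomial.map_mul, hPT, Polynomial.map_add, Polynomial.map_pow,
      C_two_dvd_iff_map_eq_zero.mp (dvd_mul_right _ _), add_zero]
  have hle := natDegree_le_of_dvd hdvd hD2
  rw [hP.natDegree_map] at hle
  exact (hle.trans natDegree_map_le).not_gt hD

end doublingTower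

/-- A polynomial with positive roots and trace one less than twice its degree. -/
noncomputable def seedNum : ℤ[X] :=
  X ^ 9 - 17 * X ^ 8 + 116 * X ^ 7 - 411 * X ^ 6 + 818 * X ^ 5 - 926 * X ^ 4 + 579 * X ^ 3
    - 186 * X ^ 2 + 26 * X - 1

/-- A polynomial dominated by `seedNum / 2` at points separating the roots of `seedNum`. -/
noncomputable def seedDen : ℤ[X] :=
  X * (X - 1) ^ 2 * (X ^ 2 - 3 * X + 1)

theorem seedNum_natDegree : seedNum.natDegree = 9 := by
  unfold seedNum; compute_degree!

theorem seedNum_monic : seedNum.Monic := by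
  unfold seedNum; monicity!

theorem seedNum_nextCoeff : seedNum.nextCoeff = -17 := by
  rw [nextCoeff_of_natDegree_pos (by simp [seedNum_natDegree]), seedNum_natDegree]
  unfold seedNum
  norm_num [coeff_X, coeff_one]

theorem seedDen_natDegree_le : seedDen.natDegree ≤ 5 := by
  unfold seedDen; compute_degree

theorem seedDen_map_ne_zero : seedDen.map (algebraMap ℤ (ZMod 2)) ≠ 0 := by
  have h : seedDen.Monic := by
    unfold seedDen
    refine (monic_X.mul ((monic_X_sub_C 1).pow 2)).mul ?_
    monicity!
  exact (h.map _).ne_zero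

theorem seedNum_map_irreducible : Irreducible (seedNum.map (algebraMap ℤ (ZMod 2))) := by
  have hm : (seedNum.map (algebraMap ℤ (ZMod 2))).Monic := seedNum_monic.map _
  have hdeg : (seedNum.map (algebraMap ℤ (ZMod 2))).natDegree = 9 := by
    rw [seedNum_monic.natDegree_map, seedNum_natDegree]
  refine (hm.irreducible_iff_lt_natDegree_lt fun h => by
    rw [h, natDegree_one] at hdeg; omega).mpr
    fun q _ hqd hqdvd => ?_
  rw [hdeg, Finset.mem_Ioc] at hqd
  obtain ⟨g, hg, hgq⟩ := exists_irreducible_of_natDegree_pos hqd.1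
  have hg4 : g.natDegree ≤ 4 := by
    have := natDegree_le_of_dvd hgq (by rintro rfl; simp at hqd)
    omega
  have := Fact.mk hg
  let b := AdjoinRoot.powerBasis hg.ne_zero
  have : Module.Finite (ZMod 2) (AdjoinRoot g) := b.finite
  have : Finite (AdjoinRoot g) := Module.finite_of_finite (ZMod 2)
  have := Fintype.ofFinite (AdjoinRoot g)
  have hcard : Fintype.card (AdjoinRoot g) = 2 ^ g.natDegree := by
    rw [Module.card_eq_pow_finrank (K := ZMod 2), b.finrank, ZMod.card]
    rfl
  set x := AdjoinRoot.root g
  have hx : x ^ 2 ^ g.natDegree = x := hcard ▸ FiniteField.pow_card x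
  have h2 : (2 : AdjoinRoot g) = 0 := by
    have := congrArg (algebraMap (ZMod 2) (AdjoinRoot g)) (show (2 : ZMod 2) = 0 from rfl)
    rwa [map_ofNat, map_zero] at this
  have hroot : x ^ 9 + x ^ 8 + x ^ 6 + x ^ 3 + 1 = 0 := by
    have h0 : aeval x seedNum = 0 := by
      rw [← aeval_map_algebraMap (ZMod 2)]
      obtain ⟨w, hw⟩ := hgq.trans hqdvd
      rw [hw, map_mul, AdjoinRoot.aeval_eq, AdjoinRoot.mk_self, zero_mul]
    simp only [seedNum, map_sub, map_add, map_mul, map_pow, aeval_X, map_ofNat, map_one] at h0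
    linear_combination h0 + (9 * x ^ 8 - 58 * x ^ 7 + 206 * x ^ 6 - 409 * x ^ 5 + 463 * x ^ 4
      - 289 * x ^ 3 + 93 * x ^ 2 - 13 * x + 1) * h2
  refine one_ne_zero (α := AdjoinRoot g) ?_
  have hcases : x ^ 8 = x ∨ x ^ 16 = x := by
    have hpos : 0 < g.natDegree := hg.natDegree_pos
    generalize g.natDegree = d at hx hg4 hpos
    interval_cases d <;> norm_num at hx
    · right
      linear_combination (x ^ 14 + x ^ 13 + x ^ 12 + x ^ 11 + x ^ 10 + x ^ 9 + x ^ 8 + x ^ 7 + x ^ 6 + x ^ 5 +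
        x ^ 4 + x ^ 3 + x ^ 2 + x + 1) * hx
    · right
      linear_combination (x ^ 12 + x ^ 9 + x ^ 6 + x ^ 3 + 1) * hx
    · exact .inl hx
    · exact .inr hx
  rcases hcases with hx' | hx'
  · linear_combination (x ^ 7 + x ^ 6 + x ^ 4 + x + 1) * hroot + (x ^ 8 + x ^ 6 + x ^ 2 + 1) * hx'
        - (x ^ 16 + x ^ 15 + x ^ 14 + x ^ 13 + x ^ 12 + 2 * x ^ 10 + x ^ 9 + x ^ 8 + x ^ 7 + x ^ 6 + x ^ 4) * h2
  · linear_combination (x ^ 15 + x ^ 12 + x ^ 10 + x ^ 8 + x ^ 7 + x ^ 6 + x ^ 2 + x + 1) * hroot + (x ^ 8 + x ^ 7 + x ^ 4 + x ^ 3 + x ^ 2 + x + 1) * hx'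
        - (x ^ 24 + x ^ 23 + x ^ 21 + x ^ 20 + x ^ 19 + 2 * x ^ 18 + x ^ 17 + 2 * x ^ 16 + 2 * x ^ 15 + x ^ 14 + x ^ 13 + x ^ 12 + x ^ 11 + 2 * x ^ 10 + x ^ 9 + x ^ 8 + x ^ 7 + x ^ 6) * h2

theorem seed_roots_pos (c : ℝ) (hc₁ : -2 ≤ c) (hc₂ : c ≤ 2) (z : ℂ)
    (hz : aeval z seedNum = c * aeval z seedDen) : ∃ x : ℝ, 0 < x ∧ (x : ℂ) = z := by
  have hlt : (C c * seedDen.map (algebraMap ℤ ℝ)).natDegree <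
      (seedNum.map (algebraMap ℤ ℝ)).natDegree := by
    rw [seedNum_monic.natDegree_map, seedNum_natDegree]
    exact ((natDegree_C_mul_le _ _).trans (natDegree_map_le.trans seedDen_natDegree_le)).trans_lt
      (by norm_num)
  have hmonic : (seedNum.map (algebraMap ℤ ℝ) - C c * seedDen.map (algebraMap ℤ ℝ)).Monic :=
    (seedNum_monic.map _).sub_of_left (degree_lt_degree hlt)
  have hdeg : (seedNum.map (algebraMap ℤ ℝ) - C c * seedDen.map (algebraMap ℤ ℝ)).natDegree = 9 := by
    rw [natDegree_sub_eq_left_of_natDegree_lt hlt, seedNum_monic.natDegree_map, seedNum_natDegree]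
  have heval (x : ℝ) :
      (seedNum.map (algebraMap ℤ ℝ) - C c * seedDen.map (algebraMap ℤ ℝ)).eval x =
      (x ^ 9 - 17 * x ^ 8 + 116 * x ^ 7 - 411 * x ^ 6 + 818 * x ^ 5 - 926 * x ^ 4 + 579 * x ^ 3
        - 186 * x ^ 2 + 26 * x - 1) - c * (x * (x - 1) ^ 2 * (x ^ 2 - 3 * x + 1)) := by
    simp [seedNum, seedDen]
  have hroot : aeval z (seedNum.map (algebraMap ℤ ℝ) - C c * seedDen.map (algebraMap ℤ ℝ)) = 0 := by
    rw [map_sub, map_mul, aeval_map_algebraMap, aeval_map_algebraMap, aeval_C, hz]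
    simp
  refine exists_real_eq_of_alternating (n := 9)
    (ξ := ![0, 1 / 5, 1 / 3, 2 / 3, 1, 5 / 3, 5 / 2, 10 / 3, 9 / 2, 7]) hmonic hdeg ?_ ?_ hroot
  · refine Fin.strictMono_iff_lt_succ.mpr fun i => ?_
    fin_cases i
    exacts [show (0 : ℝ) < 1 / 5 by norm_num,
      show (1 / 5 : ℝ) < 1 / 3 by norm_num,
      show (1 / 3 : ℝ) < 2 / 3 by norm_num,
      show (2 / 3 : ℝ) < 1 by norm_num,
      show (1 : ℝ) < 5 / 3 by norm_num,
      show (5 / 3 : ℝ) < 5 / 2 by norm_num,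
      show (5 / 2 : ℝ) < 10 / 3 by norm_num,
      show (10 / 3 : ℝ) < 9 / 2 by norm_num,
      show (9 / 2 : ℝ) < 7 by norm_num]
  · set Q := seedNum.map (algebraMap ℤ ℝ) - C c * seedDen.map (algebraMap ℤ ℝ)
    have ha : eval (0) Q < 0 := by rw [heval]; norm_num
    have hb : eval (1 / 5) Q > 0 := by rw [heval]; norm_num; linarith
    have hc : eval (1 / 3) Q < 0 := by rw [heval]; norm_num; linarith
    have hd : eval (2 / 3) Q > 0 := by rw [heval]; norm_num; linarith
    have he : eval (1) Q < 0 := by rw [heval]; norm_num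
    have hf : eval (5 / 3) Q > 0 := by rw [heval]; norm_num; linarith
    have hg : eval (5 / 2) Q < 0 := by rw [heval]; norm_num; linarith
    have hh : eval (10 / 3) Q > 0 := by rw [heval]; norm_num; linarith
    have hi : eval (9 / 2) Q < 0 := by rw [heval]; norm_num; linarith
    have hj : eval (7) Q > 0 := by rw [heval]; norm_num; linarith
    intro i
    fin_cases i
    exacts [mul_neg_of_neg_of_pos ha hb, mul_neg_of_pos_of_neg hb hc, mul_neg_of_neg_of_pos hc hd, mul_neg_of_pos_of_neg hd he, mul_neg_of_neg_of_pos he hf, mul_neg_of_pos_of_neg hf hg, mul_neg_of_neg_of_pos hg hh, mul_neg_of_pos_of_neg hh hi, mul_neg_of_neg_of_pos hi hj]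

theorem exists_isTotallyPositiveAlgInt_of_irreducible {G : ℤ[X]} (hG : G.Monic)
    (hirr : Irreducible G) (hpos : ∀ z : ℂ, aeval z G = 0 → ∃ x : ℝ, 0 < x ∧ (x : ℂ) = z) :
    ∃ θ : ℝ, IsTotallyPositiveAlgInt θ ∧ (minpoly ℚ θ).natDegree = G.natDegree ∧
      traceQ θ = -G.nextCoeff := by
  have hdeg : 0 < G.natDegree := hG.natDegree_pos_of_not_isUnit hirr.not_isUnit
  obtain ⟨z, hz⟩ := IsAlgClosed.exists_aeval_eq_zero ℂ G (natDegree_pos_iff_degree_pos.mp hdeg).ne'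
  obtain ⟨θ, -, rfl⟩ := hpos z hz
  have hθ : aeval θ G = 0 := by
    have h : aeval (algebraMap ℝ ℂ θ) G = 0 := hz
    rw [aeval_algebraMap_apply] at h
    exact (algebraMap ℝ ℂ).injective (h.trans (map_zero _).symm)
  have hmin : G.map (algebraMap ℤ ℚ) = minpoly ℚ θ :=
    minpoly.eq_of_irreducible_of_monic
      ((hG.irreducible_iff_irreducible_map_fraction_map (K := ℚ)).mp hirr)
      (by rw [aeval_map_algebraMap, hθ]) (hG.map _)
  refine ⟨θ, ⟨⟨G, hG, hθ⟩, fun w hw => ?_⟩, ?_, ?_⟩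
  · rw [conjugatesC, ← hmin] at hw
    have hw0 := (mem_roots'.mp hw).2
    rw [IsRoot.def, eval_map_algebraMap, aeval_map_algebraMap] at hw0
    obtain ⟨x, hx, rfl⟩ := hpos w hw0
    simpa using hx
  · rw [← hmin, hG.natDegree_map]
  · rw [traceQ, ← hmin, hG.natDegree_map, coeff_map, nextCoeff_of_natDegree_pos hdeg]
    simp

theorem exists_isTotallyPositiveAlgInt_trace_eq (j : ℕ) :
    ∃ θ : ℝ, IsTotallyPositiveAlgInt θ ∧ (minpoly ℚ θ).natDegree = 9 * 2 ^ (j + 1) ∧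
      traceQ θ = 17 * 2 ^ (j + 1) := by
  have hD : seedDen.natDegree < seedNum.natDegree := by
    rw [seedNum_natDegree]; exact seedDen_natDegree_le.trans_lt (by norm_num)
  obtain ⟨hm, hd⟩ := doublingTower_monic_and_natDegree seedNum_monic hD (j + 1)
  obtain ⟨θ, hθ, hdeg, htr⟩ := exists_isTotallyPositiveAlgInt_of_irreducible hm
    (doublingTower_succ_irreducible seedNum_monic hD seedNum_map_irreducible
      seedDen_map_ne_zero j)
    fun z hz => doublingTower_roots_pos seed_roots_pos (j + 1) 0 (by norm_num) (by norm_num) z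
      (by simpa using hz)
  refine ⟨θ, hθ, ?_, ?_⟩
  · rw [hdeg, hd, seedNum_natDegree, mul_comm]
  · rw [htr, doublingTower_nextCoeff seedNum_monic hD, seedNum_nextCoeff]
    push_cast; ring

theorem eventually_log_log_div_log_log_log_lt :
    ∀ᶠ x : ℝ in Filter.atTop,
      (1 / 4) * Real.log (Real.log x) / Real.log (Real.log (Real.log x)) < x / 9 := by
  have hlog := Real.tendsto_log_atTop
  filter_upwards [hlog.eventually_ge_atTop 1, Filter.eventually_gt_atTop 0,
    (hlog.comp (hlog.comp hlog)).eventually_ge_atTop 3] with x h₁ h₀ h₃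
  simp only [Function.comp_apply] at h₃
  have h₅ := Real.log_le_sub_one_of_pos h₀
  have h₆ := Real.log_le_sub_one_of_pos (zero_lt_one.trans_le h₁)
  rw [div_lt_iff₀ (by linarith)]
  nlinarith

/-- For infinitely many `n` there is a totally positive algebraic integer of degree `n`
and trace less than `2n - (1/4) log log n / log log log n`. -/
theorem totally_positive_small_trace_infinitely_often :
    {n : ℕ | ∃ θ : ℝ, IsTotallyPositiveAlgInt θ ∧ (minpoly ℚ θ).natDegree = n ∧
      (traceQ θ : ℝ) <
        2 * n - (1 / 4) * Real.log (Real.log n) / Real.log (Real.log (Real.log n))}.Infinite := by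
  have htend : Filter.Tendsto (fun j : ℕ => 9 * 2 ^ (j + 1)) Filter.atTop Filter.atTop :=
    (strictMono_nat_of_lt_succ fun j => by rw [pow_succ _ (j + 1)]; have := Nat.two_pow_pos (j + 1); omega).tendsto_atTop
  have hev := htend.eventually
    (tendsto_natCast_atTop_atTop.eventually eventually_log_log_div_log_log_log_lt)
  refine Set.infinite_of_forall_exists_gt fun N => ?_
  obtain ⟨j, hj, hN⟩ := (hev.and (htend.eventually_gt_atTop N)).exists
  refine ⟨_, ?_, hN⟩
  obtain ⟨θ, hθ, hdeg, htr⟩ := exists_isTotallyPositiveAlgInt_trace_eq j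
  refine ⟨θ, hθ, hdeg, ?_⟩
  rw [htr]
  push_cast at hj ⊢
  linarith
end

section
/- Let V be an affine variety in G_m^n defined over ℚ by polynomial equations Σ_i a_{ℓi}·x^i = 0 (ℓ = 1, …, L) of total degree d, where i ranges over exponent vectors in ℤ^n. Let N(V) = { i ∈ ℤ^n : a_{ℓi} ≠ 0 for some ℓ }, let N = #N(V) (so N ≤ C(n+d, d)), and let D(V) be the diameter of N(V) in the Euclidean metric. Then every maximal torsion coset on V of dimension n − k has an exponent of the form m·P_N for some positive integer m ≤ D(V)^{2k}·k^{k/2}. -/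
/-- An `r`-dimensional subtorus of `G_m^n = (ℂ*)^n`: the subgroup of points
`x i = ∏_j (t j) ^ (E j i)` determined by an `r × n` integer matrix `E` of rank `r`. -/
def IsSubtorusOfDim (n r : ℕ) (H : Set (Fin n → ℂˣ)) : Prop :=
  ∃ E : Matrix (Fin r) (Fin n) ℤ, (E.map (Int.cast : ℤ → ℚ)).rank = r ∧
    H = { x | ∃ t : Fin r → ℂˣ, ∀ i, x i = ∏ j, t j ^ E j i }

/-- A subtorus of `G_m^n` (of some dimension). -/
def IsSubtorus (n : ℕ) (H : Set (Fin n → ℂˣ)) : Prop :=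
  ∃ r, IsSubtorusOfDim n r H

/-- A root of unity in `ℂˣ`. -/
def IsTorsionUnit (ω : ℂˣ) : Prop :=
  ∃ k : ℕ, 0 < k ∧ ω ^ k = 1

/-- An `r`-dimensional torsion coset of `G_m^n`: a translate `ω H` of an `r`-dimensional
subtorus `H` by a torsion point `ω` (all coordinates roots of unity). -/
def IsTorsionCosetOfDim (n r : ℕ) (C : Set (Fin n → ℂˣ)) : Prop :=
  ∃ (ω : Fin n → ℂˣ) (H : Set (Fin n → ℂˣ)), IsSubtorusOfDim n r H ∧
    (∀ i, IsTorsionUnit (ω i)) ∧ C = (fun h => ω * h) '' H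

/-- A torsion coset of `G_m^n` (of some dimension). -/
def IsTorsionCoset (n : ℕ) (C : Set (Fin n → ℂˣ)) : Prop :=
  ∃ r, IsTorsionCosetOfDim n r C

/-- A maximal torsion coset of a variety `V ⊆ G_m^n`: a torsion coset contained in `V` that is
not properly contained in any other torsion coset contained in `V`. -/
def IsMaximalTorsionCosetOf (n : ℕ) (C V : Set (Fin n → ℂˣ)) : Prop :=
  IsTorsionCoset n C ∧ C ⊆ V ∧
    ∀ C', IsTorsionCoset n C' → C' ⊆ V → C ⊆ C' → C = C'

/-- `K` is an exponent of the torsion coset `C = ω H`: a multiple of the order of `ω H` in the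
quotient group `G_m^n / H`, i.e. `ω ^ K ∈ H`. -/
def IsExponentOf (n : ℕ) (K : ℕ) (C : Set (Fin n → ℂˣ)) : Prop :=
  ∃ (ω : Fin n → ℂˣ) (H : Set (Fin n → ℂˣ)), IsSubtorus n H ∧
    (∀ i, IsTorsionUnit (ω i)) ∧ C = (fun h => ω * h) '' H ∧ ω ^ K ∈ H

open Polynomial in
theorem aeval_pow_eq_zero_of_coprime {M j : ℕ} {ζ : ℂ} (hM : 0 < M) (hζ : IsPrimitiveRoot ζ M)
    (hj : j.Coprime M) {f : ℚ[X]} (hf : aeval ζ f = 0) : aeval (ζ ^ j) f = 0 := by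
  have h := minpoly.dvd ℚ ζ hf
  rw [← cyclotomic_eq_minpoly_rat hζ hM,
    cyclotomic_eq_minpoly_rat (hζ.pow_of_coprime j hj) hM] at h
  exact aeval_eq_zero_of_dvd_aeval_eq_zero h (minpoly.aeval _ _)

theorem sum_mul_pow_eq_zero_of_coprime {ι : Type*} {M j : ℕ} (hM : 0 < M) (hj : j.Coprime M)
    (B : Finset ι) (a : ι → ℚ) (w : ι → ℂ) (hw : ∀ i ∈ B, w i ^ M = 1)
    (h0 : ∑ i ∈ B, (a i : ℂ) * w i = 0) : ∑ i ∈ B, (a i : ℂ) * w i ^ j = 0 := by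
  have hζ := Complex.isPrimitiveRoot_exp M hM.ne'
  have : NeZero M := ⟨hM.ne'⟩
  set ζ := Complex.exp (2 * Real.pi * Complex.I / M)
  have hk : ∀ i, ∃ e : ℕ, i ∈ B → ζ ^ e = w i := by
    intro i
    by_cases hi : i ∈ B
    · obtain ⟨e, -, he⟩ := hζ.eq_pow_of_pow_eq_one (hw i hi)
      exact ⟨e, fun _ => he⟩
    · exact ⟨0, fun h => absurd h hi⟩
  choose e he using hk
  have key := aeval_pow_eq_zero_of_coprime hM hζ hj
    (f := ∑ i ∈ B, Polynomial.C (a i) * Polynomial.X ^ e i) (by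
      rw [← h0, map_sum]
      refine Finset.sum_congr rfl fun i hi => ?_
      simp [he i hi])
  rw [← key, map_sum]
  refine Finset.sum_congr rfl fun i hi => ?_
  rw [← he i hi]
  simp only [map_mul, Polynomial.aeval_C, map_pow, Polynomial.aeval_X, eq_ratCast]
  rw [← pow_mul, ← pow_mul, mul_comm j]

theorem sum_pow_eq_ite_of_pow_eq_one {p : ℕ} {x : ℂ} (hx : x ^ p = 1) :
    ∑ t ∈ Finset.range p, x ^ t = if x = 1 then (p : ℂ) else 0 := by
  split_ifs with h
  · simp [h]
  · have := mul_geom_sum x p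
    rw [hx, sub_self] at this
    exact (mul_eq_zero.1 this).resolve_left (sub_ne_zero.2 h)

/-- Fourier inversion on the `p`-th roots of unity. -/
theorem prime_mul_sum_filter_eq {ι : Type*} {p M₁ : ℕ} (B : Finset ι) (a : ι → ℚ)
    (w : ι → ℂ) (hw : ∀ i ∈ B, w i ^ (p * M₁) = 1) {ω : ℂ} (hω : ω ^ p = 1) :
    (p : ℂ) * ∑ i ∈ B with w i ^ M₁ = ω, (a i : ℂ) * w i =
      ∑ t ∈ Finset.range p, (ω⁻¹) ^ t * ∑ i ∈ B, (a i : ℂ) * w i ^ (1 + t * M₁) := by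
  rcases Nat.eq_zero_or_pos p with rfl | hp
  · simp
  have hω0 : ω ≠ 0 := by
    rintro rfl
    simp [hp.ne'] at hω
  simp_rw [Finset.mul_sum]
  rw [Finset.sum_comm, Finset.sum_filter]
  refine Finset.sum_congr rfl fun i hi => ?_
  have h1 : (w i ^ M₁ * ω⁻¹) ^ p = 1 := by
    rw [mul_pow, ← pow_mul, mul_comm M₁, hw i hi, inv_pow, hω, inv_one, one_mul]
  have h2 := sum_pow_eq_ite_of_pow_eq_one h1
  have h3 : ∀ t, (ω⁻¹) ^ t * ((a i : ℂ) * w i ^ (1 + t * M₁)) =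
      ((a i : ℂ) * w i) * (w i ^ M₁ * ω⁻¹) ^ t := by
    intro t
    rw [mul_pow, pow_add, pow_one, mul_comm t, pow_mul]
    ring
  simp_rw [h3]
  rw [← Finset.mul_sum, h2]
  simp only [mul_inv_eq_one₀ hω0]
  split_ifs <;> ring

theorem sum_filter_pow_eq_zero {ι : Type*} {p M₁ : ℕ} (hp : p.Prime)
    (hM₁ : 0 < M₁) (B : Finset ι) (hB : p ∣ M₁ ∨ B.card < p) (a : ι → ℚ)
    (w : ι → ℂ) (hw : ∀ i ∈ B, w i ^ (p * M₁) = 1)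
    (h0 : ∑ i ∈ B, (a i : ℂ) * w i = 0) (ω : ℂ) :
    ∑ i ∈ B with w i ^ M₁ = ω, (a i : ℂ) * w i = 0 := by
  have hp0 : (p : ℂ) ≠ 0 := by exact_mod_cast hp.ne_zero
  by_cases hω : ω ^ p = 1
  swap
  · rw [Finset.sum_eq_zero]
    intro i hi
    rw [Finset.mem_filter] at hi
    refine absurd ?_ hω
    rw [← hi.2, ← pow_mul, mul_comm, hw i hi.1]
  have hG : ∀ t, ¬ p ∣ 1 + t * M₁ → ∑ i ∈ B, (a i : ℂ) * w i ^ (1 + t * M₁) = 0 := by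
    intro t ht
    refine sum_mul_pow_eq_zero_of_coprime (Nat.mul_pos hp.pos hM₁) ?_ B a w hw h0
    refine Nat.Coprime.mul_right ((hp.coprime_iff_not_dvd.2 ht).symm) ?_
    simp
  suffices hall : ∀ t < p, ∑ i ∈ B, (a i : ℂ) * w i ^ (1 + t * M₁) = 0 by
    have h := prime_mul_sum_filter_eq B a w hw hω
    refine (mul_eq_zero.1 (h.trans (Finset.sum_eq_zero fun t ht => ?_))).resolve_left hp0
    rw [hall t (Finset.mem_range.1 ht), mul_zero]
  intro t₀ ht₀
  by_cases hbad : p ∣ 1 + t₀ * M₁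
  swap
  · exact hG t₀ hbad
  have hpM : ¬ p ∣ M₁ := fun h =>
    hp.one_lt.ne' (Nat.dvd_one.1 ((Nat.dvd_add_left (h.mul_left t₀)).1 hbad))
  have hcard := hB.resolve_left hpM
  have huniq : ∀ t < p, t ≠ t₀ → ¬ p ∣ 1 + t * M₁ := by
    intro t ht hne hd
    have h1 : (p : ℤ) ∣ ((t : ℤ) - t₀) * M₁ := by
      have := dvd_sub (Int.natCast_dvd_natCast.2 hd) (Int.natCast_dvd_natCast.2 hbad)
      push_cast at this
      rwa [add_sub_add_left_eq_sub, ← sub_mul] at this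
    rcases (Nat.prime_iff_prime_int.1 hp).dvd_or_dvd h1 with h | h
    · have := Int.eq_zero_of_abs_lt_dvd h (by rw [abs_lt]; constructor <;> omega)
      omega
    · exact hpM (Int.natCast_dvd_natCast.1 h)
  have hζ := Complex.isPrimitiveRoot_exp p hp.ne_zero
  obtain ⟨η, hη, hηB⟩ : ∃ η ∈ Polynomial.nthRootsFinset p (1 : ℂ),
      η ∉ B.image fun i => w i ^ M₁ := by
    refine Finset.exists_mem_notMem_of_card_lt_card ?_
    rw [hζ.card_nthRootsFinset]
    exact Finset.card_image_le.trans_lt hcard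
  have hηp : η ^ p = 1 := (Polynomial.mem_nthRootsFinset hp.pos _).1 hη
  have h := prime_mul_sum_filter_eq B a w hw hηp
  rw [Finset.filter_false_of_mem fun i hi h => hηB (Finset.mem_image.2 ⟨i, hi, h⟩),
    Finset.sum_empty, mul_zero, Finset.sum_eq_single t₀] at h
  · refine (mul_eq_zero.1 h.symm).resolve_left (pow_ne_zero _ (inv_ne_zero ?_))
    rintro rfl
    simp [hp.ne_zero] at hηp
  · intro t ht hne
    rw [hG t (huniq t (Finset.mem_range.1 ht) hne), mul_zero]
  · intro h
    exact absurd (Finset.mem_range.2 ht₀) h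

theorem dvd_primorial {M N : ℕ}
    (h : ∀ p M₁ : ℕ, p.Prime → M = p * M₁ → p ≤ N ∧ ¬ p ∣ M₁) : M ∣ primorial N := by
  have hsq : Squarefree M := by
    rw [Nat.squarefree_iff_prime_squarefree]
    rintro p hp ⟨c, hc⟩
    exact (h p (p * c) hp (by rw [hc, mul_assoc])).2 (dvd_mul_right _ _)
  rw [← Nat.prod_primeFactors_of_squarefree hsq, primorial]
  refine Finset.prod_dvd_prod_of_subset _ _ _ fun p hp => ?_
  have hpp := Nat.prime_of_mem_primeFactors hp
  obtain ⟨c, hc⟩ := Nat.dvd_of_mem_primeFactors hp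
  have := (h p c hpp hc).1
  simp [hpp]
  omega

/-- Mann's theorem for a minimal vanishing sum of roots of unity with coefficients in a
power of `ℚ`. -/
theorem div_pow_primorial_card_eq_one {ι κ : Type*} (B : Finset ι) (a : κ → ι → ℚ)
    (z : ι → ℂˣ) {K : ℕ} (hK : 0 < K) (hz : ∀ i ∈ B, z i ^ K = 1)
    (h0 : ∀ ℓ, ∑ i ∈ B, (a ℓ i : ℂ) * z i = 0)
    (hmin : ∀ A ⊆ B, A.Nonempty → (∀ ℓ, ∑ i ∈ A, (a ℓ i : ℂ) * z i = 0) → A = B)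
    {i₀ i : ι} (hi₀ : i₀ ∈ B) (hi : i ∈ B) : (z i / z i₀) ^ primorial B.card = 1 := by
  have hex : ∃ M, 0 < M ∧ ∀ i ∈ B, (z i / z i₀) ^ M = 1 :=
    ⟨K, hK, fun j hj => by rw [div_pow, hz j hj, hz i₀ hi₀, div_one]⟩
  classical
  have hfind := Nat.find_spec hex
  have hle := fun m => Nat.find_min' (m := m) hex
  set M := Nat.find hex
  suffices h : M ∣ primorial B.card by
    obtain ⟨c, hc⟩ := h
    rw [hc, pow_mul, hfind.2 i hi, one_pow]
  refine dvd_primorial fun p M₁ hp hM => ?_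
  by_contra hcon
  have hB : p ∣ M₁ ∨ B.card < p := by
    by_contra! h
    exact hcon ⟨h.2, h.1⟩
  have hM₁ : 0 < M₁ := Nat.pos_of_ne_zero fun h => by
    rw [h, mul_zero] at hM
    exact hfind.1.ne' hM
  have hdiv : ∀ j, ((z j / z i₀ : ℂˣ) : ℂ) = z j / z i₀ := fun j => by simp
  have hsum : ∀ (A : Finset ι) (ℓ : κ), ∑ i ∈ A, (a ℓ i : ℂ) * ((z i / z i₀ : ℂˣ) : ℂ) =
      (∑ i ∈ A, (a ℓ i : ℂ) * z i) / z i₀ := by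
    intro A ℓ
    rw [Finset.sum_div]
    exact Finset.sum_congr rfl fun j _ => by rw [hdiv, mul_div_assoc]
  have hA := hmin {j ∈ B | ((z j / z i₀ : ℂˣ) : ℂ) ^ M₁ = 1} (Finset.filter_subset _ _)
    ⟨i₀, by simp [hi₀]⟩ (by
      intro ℓ
      have h := sum_filter_pow_eq_zero hp hM₁ B hB (a ℓ) (fun j => ((z j / z i₀ : ℂˣ) : ℂ))
        (fun j hj => by
          have := hfind.2 j hj
          rw [hM] at this
          rw [← Units.val_pow_eq_pow_val, this, Units.val_one]) (by rw [hsum, h0, zero_div]) 1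
      rw [hsum] at h
      exact (div_eq_zero_iff.1 h).resolve_right (Units.ne_zero _))
  have hlt : M ≤ M₁ := hle M₁ ⟨hM₁, fun j hj => by
    rw [← hA, Finset.mem_filter] at hj
    exact Units.ext (by rw [Units.val_pow_eq_pow_val, hj.2, Units.val_one])⟩
  have := hp.two_le
  nlinarith
/-- The value of the Laurent monomial with exponent vector `u` at the point `x`. -/
def laurentMonomial {ι : Type*} [Fintype ι] (x : ι → ℂˣ) (u : ι → ℤ) : ℂˣ := ∏ j, x j ^ u j

/-- The subtorus parametrised by the matrix `E`. -/
def subtorus {κ ι : Type*} [Fintype κ] (E : Matrix κ ι ℤ) : Set (ι → ℂˣ) :=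
  { x | ∃ t : κ → ℂˣ, ∀ i, x i = ∏ j, t j ^ E j i }

section laurentMonomial

variable {ι : Type*} [Fintype ι]

theorem laurentMonomial_mul (x y : ι → ℂˣ) (u : ι → ℤ) :
    laurentMonomial (x * y) u = laurentMonomial x u * laurentMonomial y u := by
  simp [laurentMonomial, mul_zpow, Finset.prod_mul_distrib]

theorem laurentMonomial_one (u : ι → ℤ) : laurentMonomial 1 u = 1 := by
  simp [laurentMonomial]

theorem laurentMonomial_pow (x : ι → ℂˣ) (k : ℕ) (u : ι → ℤ) :
    laurentMonomial (x ^ k) u = laurentMonomial x u ^ k := by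
  simp only [laurentMonomial, Pi.pow_apply, ← Finset.prod_pow]
  exact Finset.prod_congr rfl fun j _ => by rw [← zpow_natCast, zpow_comm, zpow_natCast]

theorem laurentMonomial_sub (x : ι → ℂˣ) (u v : ι → ℤ) :
    laurentMonomial x (u - v) = laurentMonomial x u / laurentMonomial x v := by
  simp [laurentMonomial, zpow_sub, Finset.prod_mul_distrib, div_eq_mul_inv]

theorem laurentMonomial_smul (x : ι → ℂˣ) (c : ℤ) (u : ι → ℤ) :
    laurentMonomial x (c • u) = laurentMonomial x u ^ c := by
  simp [laurentMonomial, zpow_mul', Finset.prod_zpow]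

theorem laurentMonomial_sum (x : ι → ℂˣ) {α : Type*} (s : Finset α) (u : α → ι → ℤ) :
    laurentMonomial x (∑ i ∈ s, u i) = ∏ i ∈ s, laurentMonomial x (u i) := by
  simp only [laurentMonomial, Finset.sum_apply]
  rw [Finset.prod_comm]
  refine Finset.prod_congr rfl fun j _ => ?_
  classical
  induction s using Finset.induction_on with
  | empty => simp
  | insert a s ha ih => rw [Finset.sum_insert ha, Finset.prod_insert ha, zpow_add, ih]

theorem laurentMonomial_param {κ : Type*} [Fintype κ] (E : Matrix κ ι ℤ) (t : κ → ℂˣ)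
    (u : ι → ℤ) :
    laurentMonomial (fun i => ∏ j, t j ^ E j i) u = laurentMonomial t (E.mulVec u) := by
  have h : E.mulVec u = ∑ i, u i • fun j => E j i := by
    ext j
    simp [Matrix.mulVec, dotProduct, mul_comm]
  rw [h, laurentMonomial_sum]
  simp only [laurentMonomial_smul]
  rfl

theorem eq_zero_of_forall_laurentMonomial_eq_one {u : ι → ℤ}
    (h : ∀ x : ι → ℂˣ, laurentMonomial x u = 1) : u = 0 := by
  classical
  ext j
  have h1 := h (Pi.mulSingle j (Units.mk0 2 two_ne_zero))
  rw [laurentMonomial, Finset.prod_eq_single j] at h1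
  · rw [Pi.mulSingle_eq_same] at h1
    have h2 := congrArg (fun z : ℂˣ => ‖(z : ℂ)‖) h1
    simp only [Units.val_zpow_eq_zpow_val, Units.val_mk0, norm_zpow, Units.val_one, norm_one,
      Complex.norm_ofNat] at h2
    exact (zpow_eq_one_iff_right₀ (by norm_num) (by norm_num)).1 h2
  · intro i _ hi
    rw [Pi.mulSingle_eq_of_ne hi, one_zpow]
  · simp

end laurentMonomial

theorem baer_additive_complex_units : Module.Baer ℤ (Additive ℂˣ) := by
  have : DivisibleBy (Additive ℂˣ) ℕ := by
    refine divisibleByOfSMulRightSurj _ _ fun {k} hk y => ?_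
    obtain ⟨z, hz⟩ := IsAlgClosed.exists_pow_nat_eq (y.toMul : ℂ) (Nat.pos_of_ne_zero hk)
    have hz0 : z ≠ 0 := by
      rintro rfl
      rw [zero_pow hk] at hz
      exact (Units.ne_zero _) hz.symm
    exact ⟨Additive.ofMul (Units.mk0 z hz0), Additive.toMul.injective (Units.ext hz)⟩
  have : DivisibleBy (Additive ℂˣ) ℤ := AddGroup.divisibleByIntOfDivisibleByNat _
  exact Module.Baer.of_divisible _

theorem map_intCast_mulVec {κ ι : Type*} [Fintype ι] (F : Matrix κ ι ℤ)
    (u : ι → ℤ) :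
    (F.map (Int.cast : ℤ → ℚ)).mulVec (fun i => (u i : ℚ)) =
      fun j => ((F.mulVec u j : ℤ) : ℚ) := by
  ext j
  simp [Matrix.mulVec, dotProduct]

section subtorus

variable {κ ι : Type*} [Fintype κ] [Fintype ι]

theorem mem_subtorus_iff (E : Matrix κ ι ℤ) (x : ι → ℂˣ) :
    x ∈ subtorus E ↔ ∀ u, E.mulVec u = 0 → laurentMonomial x u = 1 := by
  classical
  constructor
  · rintro ⟨t, ht⟩ u hu
    rw [show x = fun i => ∏ j, t j ^ E j i from funext ht, laurentMonomial_param, hu]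
    simp [laurentMonomial]
  · intro h
    let φ : (ι → ℤ) →ₗ[ℤ] Additive ℂˣ :=
      Fintype.linearCombination ℤ fun j => Additive.ofMul (x j)
    have hφ : ∀ u, φ u = Additive.ofMul (laurentMonomial x u) := fun u => by
      simp [φ, Fintype.linearCombination_apply, laurentMonomial, ofMul_prod]
    let f := E.mulVecLin
    have hker : LinearMap.ker f ≤ LinearMap.ker φ := fun u hu => by
      rw [LinearMap.mem_ker, hφ, h u hu, ofMul_one]
    obtain ⟨g, hg⟩ := baer_additive_complex_units.extension_property
      ((LinearMap.ker f).liftQ f le_rfl)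
      (LinearMap.ker_eq_bot.1 (Submodule.ker_liftQ_eq_bot _ _ _ le_rfl))
      ((LinearMap.ker f).liftQ φ hker)
    have hgf : ∀ u, g (f u) = φ u := fun u =>
      LinearMap.congr_fun hg (Submodule.Quotient.mk u)
    refine ⟨fun j => (g (Pi.single j 1)).toMul, fun i => ?_⟩
    have h1 := hgf (Pi.single i 1)
    have h2 : f (Pi.single i 1) = ∑ j, E j i • Pi.single j (1 : ℤ) := by
      ext j
      simp [f, Pi.single_apply, Matrix.col]
    simp only [h2, map_sum, hφ, map_smul] at h1
    have h3 : laurentMonomial x (Pi.single i 1) = x i := by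
      rw [laurentMonomial, Finset.prod_eq_single i] <;> simp +contextual
    rw [h3] at h1
    have h4 := congrArg Additive.toMul h1
    rw [toMul_ofMul] at h4
    rw [← h4, toMul_sum]
    simp

theorem subtorus_subset {κ' : Type*} [Fintype κ'] {E : Matrix κ ι ℤ} {E' : Matrix κ' ι ℤ}
    (h : ∀ u, E'.mulVec u = 0 → E.mulVec u = 0) : subtorus E ⊆ subtorus E' := fun x hx =>
  (mem_subtorus_iff E' x).2 fun u hu => (mem_subtorus_iff E x).1 hx u (h u hu)

theorem mulVec_eq_zero_of_subtorus_subset {κ' : Type*} [Fintype κ'] {E : Matrix κ ι ℤ}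
    {E' : Matrix κ' ι ℤ} (h : subtorus E' ⊆ subtorus E) {u : ι → ℤ} (hu : E.mulVec u = 0) :
    E'.mulVec u = 0 :=
  eq_zero_of_forall_laurentMonomial_eq_one fun t => by
    rw [← laurentMonomial_param]
    exact (mem_subtorus_iff E _).1 (h ⟨t, fun _ => rfl⟩) u hu

theorem exists_ne_zero_mul_eq_intCast (v : ι → ℚ) :
    ∃ (c : ℤ) (u : ι → ℤ), c ≠ 0 ∧ ∀ i, (u i : ℚ) = c * v i := by
  obtain ⟨b, hb⟩ := IsLocalization.exist_integer_multiples_of_finite (nonZeroDivisors ℤ) v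
  choose u hu using hb
  exact ⟨b, u, nonZeroDivisors.coe_ne_zero b, fun i => by simpa [Submonoid.smul_def] using hu i⟩

theorem rank_le_of_subtorus_subset {κ' : Type*} [Fintype κ'] {E : Matrix κ ι ℤ}
    {E' : Matrix κ' ι ℤ} (h : subtorus E' ⊆ subtorus E) :
    (E'.map (Int.cast : ℤ → ℚ)).rank ≤ (E.map (Int.cast : ℤ → ℚ)).rank := by
  have hle : LinearMap.ker (E.map (Int.cast : ℤ → ℚ)).mulVecLin ≤
      LinearMap.ker (E'.map (Int.cast : ℤ → ℚ)).mulVecLin := by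
    intro v hv
    rw [LinearMap.mem_ker, Matrix.mulVecLin_apply] at hv ⊢
    obtain ⟨c, u, hc, hu⟩ := exists_ne_zero_mul_eq_intCast v
    have hcv : (fun i => (u i : ℚ)) = (c : ℚ) • v := funext hu
    have h1 : E.mulVec u = 0 := by
      have := map_intCast_mulVec E u
      rw [hcv, Matrix.mulVec_smul, hv, smul_zero] at this
      ext j
      simpa using (congrFun this j).symm
    have h2 := map_intCast_mulVec E' u
    rw [mulVec_eq_zero_of_subtorus_subset h h1, hcv, Matrix.mulVec_smul] at h2
    refine (smul_eq_zero.1 (h2.trans ?_)).resolve_left (Int.cast_ne_zero.2 hc)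
    ext j
    simp
  have h1 := (E.map (Int.cast : ℤ → ℚ)).mulVecLin.finrank_range_add_finrank_ker
  have h2 := (E'.map (Int.cast : ℤ → ℚ)).mulVecLin.finrank_range_add_finrank_ker
  have h3 := Submodule.finrank_mono hle
  unfold Matrix.rank
  omega

end subtorus

section lattice

variable {ι : Type*} [Fintype ι] [DecidableEq ι]

/-- From any set `G` of integer vectors one can select linearly independent ones which span `G`
rationally, and complete them by standard basis vectors to a nonsingular square matrix `M`. The
rational coordinates of `g ∈ G` along the added rows vanish. -/
theorem exists_matrix_det_ne_zero (G : Set (ι → ℤ)) :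
    ∃ (M : Matrix ι ι ℤ) (J : Finset ι), M.det ≠ 0 ∧ (∀ i ∈ J, M i ∈ G) ∧
      (∀ i ∉ J, ∃ j, M i = Pi.single j 1) ∧
      ∀ g ∈ G, ∀ j ∉ J, Matrix.vecMul g M.adjugate j = 0 := by
  classical
  let c : (ι → ℤ) → (ι → ℚ) := fun u i => (u i : ℚ)
  let e : ι → ι → ℤ := fun j => Pi.single j 1
  obtain ⟨b, hbG, -, hGb, hb⟩ := exists_linearIndepOn_extension (K := ℚ) (v := c)
    (s := ∅) (t := G) (linearIndepOn_empty _ _) (Set.empty_subset _)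
  obtain ⟨b', hb't, hbb', hspan, hb'⟩ := exists_linearIndepOn_extension (K := ℚ) (v := c)
    (s := b) (t := b ∪ Set.range e) hb Set.subset_union_left
  have hc : ∀ j, c (e j) = Pi.single j 1 := fun j => by
    ext i
    simp [c, e, Pi.single_apply]
  have htop : ⊤ ≤ Submodule.span ℚ (Set.range fun x : b' => c x) := by
    rw [← (Pi.basisFun ℚ ι).span_eq, Submodule.span_le]
    rintro _ ⟨j, rfl⟩
    have h := hspan ⟨e j, Or.inr ⟨j, rfl⟩, rfl⟩
    rw [hc] at h
    rw [Set.image_eq_range] at h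
    simpa using h
  let β := Module.Basis.mk hb' htop
  let σ : ι ≃ b' := (Pi.basisFun ℚ ι).indexEquiv β
  let M : Matrix ι ι ℤ := fun i => σ i
  have hrows : LinearIndependent ℚ (M.map (Int.cast : ℤ → ℚ)).row :=
    (linearIndependent_equiv σ).2 hb'
  have hdet : M.det ≠ 0 := by
    intro h
    have h1 := (Matrix.isUnit_iff_isUnit_det _).1
      (Matrix.linearIndependent_rows_iff_isUnit.1 hrows)
    have h2 : (M.map (Int.cast : ℤ → ℚ)).det = ((M.det : ℤ) : ℚ) :=
      (Int.cast_det M).symm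
    rw [h2, h] at h1
    simp at h1
  refine ⟨M, ({i | (σ i : ι → ℤ) ∈ b} : Finset ι), hdet, ?_, ?_, ?_⟩
  · intro i hi
    exact hbG (by simpa using hi)
  · intro i hi
    obtain h | ⟨j, hj⟩ := hb't (σ i).2
    · simp [h] at hi
    · exact ⟨j, hj.symm⟩
  · intro g hg j hj
    let φ : (ι → ℚ) →ₗ[ℚ] ℚ :=
      LinearMap.proj j ∘ₗ (M.adjugate.map (Int.cast : ℤ → ℚ)).vecMulLinear
    have hφ : ∀ u : ι → ℤ, φ (c u) = ((Matrix.vecMul u M.adjugate j : ℤ) : ℚ) := fun u => by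
      simp [φ, c, Matrix.vecMul, dotProduct]
    have hker : Submodule.span ℚ (c '' b) ≤ LinearMap.ker φ := by
      rw [Submodule.span_le]
      rintro _ ⟨u, hu, rfl⟩
      obtain ⟨i, hi⟩ := σ.surjective ⟨u, hbb' hu⟩
      have hiu : u = M i := congrArg Subtype.val hi.symm
      have hij : i ≠ j := by
        rintro rfl
        exact hj (by simpa [hi] using hu)
      have h := congrFun (congrFun M.mul_adjugate i) j
      rw [Matrix.smul_apply, Matrix.one_apply_ne hij, smul_zero] at h
      rw [SetLike.mem_coe, LinearMap.mem_ker, hφ, hiu]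
      exact_mod_cast h
    have := hker (hGb ⟨g, hg, rfl⟩)
    rw [LinearMap.mem_ker, hφ] at this
    exact_mod_cast this

theorem abs_det_le_prod_sum_abs (M : Matrix ι ι ℤ) : |M.det| ≤ ∏ i, ∑ j, |M i j| := by
  rw [← M.det_transpose, Matrix.det_apply, Finset.prod_univ_sum]
  refine (Finset.abs_sum_le_sum_abs _ _).trans ?_
  have h : ∀ σ : Equiv.Perm ι, |Equiv.Perm.sign σ • ∏ i, M.transpose (σ i) i| =
      ∏ i, |M i (σ i)| := by
    intro σ
    rw [Units.smul_def, smul_eq_mul, abs_mul, Int.abs_eq_natAbs, Int.units_natAbs,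
      Finset.abs_prod]
    simp
  simp_rw [h]
  rw [← Finset.sum_image (s := Finset.univ) (f := fun f : ι → ι => ∏ i, |M i (f i)|)
    (g := fun σ : Equiv.Perm ι => ⇑σ) fun _ _ _ _ h => DFunLike.coe_injective h]
  exact Finset.sum_le_sum_of_subset_of_nonneg (fun f _ => by simp)
    fun f _ _ => Finset.prod_nonneg fun i _ => abs_nonneg _

theorem abs_det_le_pow {M : Matrix ι ι ℤ} {J : Finset ι} {D : ℝ}
    (hJ : ∀ i ∈ J, ∑ j, (M i j : ℝ) ^ 2 ≤ D ^ 2)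
    (hJc : ∀ i ∉ J, ∃ j, M i = Pi.single j 1) : |(M.det : ℝ)| ≤ D ^ (2 * J.card) := by
  have h1 : |(M.det : ℝ)| ≤ ∏ i, ∑ j, |(M i j : ℝ)| := by
    exact_mod_cast abs_det_le_prod_sum_abs M
  refine h1.trans ?_
  rw [← Finset.prod_mul_prod_compl J, pow_mul]
  have h2 : ∏ i ∈ Jᶜ, ∑ j, |(M i j : ℝ)| = 1 := by
    refine Finset.prod_eq_one fun i hi => ?_
    obtain ⟨j, hj⟩ := hJc i (Finset.mem_compl.1 hi)
    rw [hj, Finset.sum_eq_single j] <;> simp +contextual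
  rw [h2, mul_one]
  rw [← Finset.prod_const]
  refine Finset.prod_le_prod (fun i _ => Finset.sum_nonneg fun j _ => abs_nonneg _)
    fun i hi => (Finset.sum_le_sum fun j _ => ?_).trans (hJ i hi)
  have h3 : |M i j| ≤ M i j ^ 2 := by
    rw [← sq_abs]
    exact Int.le_self_sq _
  exact_mod_cast h3

theorem linearIndependent_adjugate {M : Matrix ι ι ℤ} (hM : M.det ≠ 0) (J : Finset ι) :
    LinearIndependent ℚ
      ((Matrix.of fun (j : {j // j ∉ J}) i => M.adjugate i j).map (Int.cast : ℤ → ℚ)).row := by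
  have h1 : IsUnit (M.adjugate.map (Int.cast : ℤ → ℚ)) := by
    rw [Matrix.isUnit_iff_isUnit_det]
    have : (M.adjugate.map (Int.cast : ℤ → ℚ)).det = ((M.adjugate.det : ℤ) : ℚ) :=
      (Int.cast_det _).symm
    rw [this, Matrix.det_adjugate, isUnit_iff_ne_zero]
    exact_mod_cast pow_ne_zero _ hM
  exact (Matrix.linearIndependent_cols_iff_isUnit.2 h1).comp _ Subtype.val_injective

theorem det_smul_eq_sum {M : Matrix ι ι ℤ} {J : Finset ι} {u : ι → ℤ}
    (hu : ∀ j ∉ J, Matrix.vecMul u M.adjugate j = 0) :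
    M.det • u = ∑ i ∈ J, Matrix.vecMul u M.adjugate i • M i := by
  have h : M.det • u = Matrix.vecMul (Matrix.vecMul u M.adjugate) M := by
    rw [Matrix.vecMul_vecMul, Matrix.adjugate_mul, Matrix.vecMul_smul, Matrix.vecMul_one]
  rw [h, Finset.sum_subset (Finset.subset_univ J) fun i _ hi => by rw [hu i hi, zero_smul]]
  ext j
  simp [Matrix.vecMul, dotProduct]

end lattice

theorem exists_partition_minimal {α : Type*} [DecidableEq α] (P : Finset α → Prop)
    (hP : ∀ A B, B ⊆ A → P A → P B → P (A \ B)) (A : Finset α) (hA : P A) :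
    ∃ F : Finset (Finset α), (F : Set (Finset α)).PairwiseDisjoint id ∧ F.biUnion id = A ∧
      ∀ B ∈ F, P B ∧ ∀ B' ⊆ B, B'.Nonempty → P B' → B' = B := by
  induction A using Finset.strongInduction with
  | H A ih =>
    rcases A.eq_empty_or_nonempty with rfl | hne
    · exact ⟨∅, by simp, by simp, by simp⟩
    classical
    obtain ⟨B, hB⟩ := Finset.exists_minimal
      (s := A.powerset.filter fun B => B.Nonempty ∧ P B) ⟨A, by simp [hne, hA]⟩
    have hmem := hB.prop
    rw [Finset.mem_filter, Finset.mem_powerset] at hmem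
    obtain ⟨hBA, hBne, hPB⟩ := hmem
    obtain ⟨F, hF, hFA, hFP⟩ := ih (A \ B) (Finset.sdiff_ssubset hBA hBne) (hP A B hBA hA hPB)
    have hdisj : ∀ B' ∈ F, Disjoint B B' := fun B' hB' => by
      have h : B' ⊆ A \ B := hFA ▸ Finset.subset_biUnion_of_mem id hB'
      exact Finset.disjoint_sdiff.mono_right h
    refine ⟨insert B F, ?_, ?_, ?_⟩
    · rw [Finset.coe_insert]
      exact hF.insert fun B' hB' _ => hdisj B' hB'
    · rw [Finset.biUnion_insert, hFA, id, Finset.union_sdiff_of_subset hBA]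
    · intro B₁ hB₁
      rcases Finset.mem_insert.1 hB₁ with rfl | h
      · refine ⟨hPB, fun B' hB' hne' hP' => ?_⟩
        refine hB'.antisymm (hB.le_of_le ?_ hB')
        simp [hB'.trans hBA, hne', hP']
      · exact hFP B₁ h

/-- Linear independence of characters of a torus. -/
theorem sum_filter_eq_zero_of_forall_sum_laurentMonomial {α κ : Type*} [Fintype κ]
    (S : Finset α) (b : α → ℂ) (f : α → κ → ℤ)
    (h : ∀ t : κ → ℂˣ, ∑ i ∈ S, b i * (laurentMonomial t (f i) : ℂ) = 0) (v : κ → ℤ) :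
    ∑ i ∈ S with f i = v, b i = 0 := by
  classical
  by_cases hv : v ∈ S.image f
  swap
  · rw [Finset.filter_false_of_mem fun i hi h => hv (Finset.mem_image.2 ⟨i, hi, h⟩),
      Finset.sum_empty]
  let χ : (κ → ℤ) → ((κ → ℂˣ) →* ℂ) := fun u => (Units.coeHom ℂ).comp
    ⟨⟨fun t => laurentMonomial t u, laurentMonomial_one u⟩, fun x y => laurentMonomial_mul x y u⟩
  have hχ : ∀ u t, χ u t = laurentMonomial t u := fun _ _ => rfl
  have hinj : Function.Injective χ := fun u w huw =>
    sub_eq_zero.1 (eq_zero_of_forall_laurentMonomial_eq_one fun t => by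
      rw [laurentMonomial_sub, div_eq_one]
      exact Units.ext (DFunLike.congr_fun huw t))
  have hli := (linearIndependent_monoidHom (κ → ℂˣ) ℂ).comp χ hinj
  refine linearIndependent_iff'.1 hli (S.image f) (fun v => ∑ i ∈ S with f i = v, b i) ?_ v hv
  ext t
  rw [Finset.sum_apply, Pi.zero_apply, ← h t,
    ← Finset.sum_fiberwise_of_maps_to fun i hi => Finset.mem_image_of_mem f hi]
  refine Finset.sum_congr rfl fun w _ => ?_
  rw [Pi.smul_apply, smul_eq_mul, Finset.sum_mul]
  refine Finset.sum_congr rfl fun i hi => ?_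
  rw [(Finset.mem_filter.1 hi).2]
  rfl

theorem isSubtorusOfDim_subtorus {n r : ℕ} {κ : Type*} [Fintype κ] (E : Matrix κ (Fin n) ℤ)
    (hE : (E.map (Int.cast : ℤ → ℚ)).rank = Fintype.card κ) (hr : Fintype.card κ = r) :
    IsSubtorusOfDim n r (subtorus E) := by
  let e : Fin r ≃ κ := (Fintype.equivFinOfCardEq hr).symm
  refine ⟨E.submatrix e id, ?_, ?_⟩
  · exact ((E.map (Int.cast : ℤ → ℚ)).rank_submatrix e (Equiv.refl _)).trans (hE.trans hr)
  · ext x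
    constructor
    · rintro ⟨t, ht⟩
      exact ⟨t ∘ e, fun i => (ht i).trans (e.prod_comp fun j => t j ^ E j i).symm⟩
    · rintro ⟨t, ht⟩
      refine ⟨t ∘ e.symm, fun i => (ht i).trans ?_⟩
      rw [← e.prod_comp]
      simp

/-- The support of a system of equations vanishing on a torsion coset splits into blocks whose
partial sums vanish on the coset, such that quotients of monomials in a block are torsion of
order dividing a primorial. -/
theorem exists_blocks {L κ ι : Type*} [Fintype κ] [Fintype ι] (S : Finset (ι → ℤ))
    (a : L → (ι → ℤ) → ℚ) (E : Matrix κ ι ℤ) (ω : ι → ℂˣ) {K : ℕ} (hK : 0 < K) (hω : ω ^ K = 1)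
    (hV : ∀ h ∈ subtorus E, ∀ ℓ, ∑ i ∈ S, (a ℓ i : ℂ) * (laurentMonomial (ω * h) i : ℂ) = 0) :
    ∃ F : Finset (Finset (ι → ℤ)), (F : Set (Finset (ι → ℤ))).PairwiseDisjoint id ∧
      F.biUnion id = S ∧ ∀ B ∈ F,
        (∀ ℓ, ∑ i ∈ B, (a ℓ i : ℂ) * (laurentMonomial ω i : ℂ) = 0) ∧
        ∀ i ∈ B, ∀ i' ∈ B, E.mulVec (i - i') = 0 ∧
          laurentMonomial ω (i - i') ^ primorial S.card = 1 := by
  classical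
  let s : Finset (ι → ℤ) → L → ℂ := fun B ℓ => ∑ i ∈ B, (a ℓ i : ℂ) * (laurentMonomial ω i : ℂ)
  let P : Finset (ι → ℤ) → Prop := fun B => ∀ v ℓ, s {i ∈ B | E.mulVec i = v} ℓ = 0
  have hPS : P S := fun v ℓ => by
    refine sum_filter_eq_zero_of_forall_sum_laurentMonomial S
      (fun i => (a ℓ i : ℂ) * (laurentMonomial ω i : ℂ)) (fun i => E.mulVec i) (fun t => ?_) v
    rw [← hV _ ⟨t, fun _ => rfl⟩ ℓ]
    refine Finset.sum_congr rfl fun i _ => ?_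
    rw [laurentMonomial_mul, laurentMonomial_param, Units.val_mul, mul_assoc]
  have hPsdiff : ∀ A B, B ⊆ A → P A → P B → P (A \ B) := fun A B hBA hA hB v ℓ => by
    have h := Finset.sum_sdiff (f := fun i => (a ℓ i : ℂ) * (laurentMonomial ω i : ℂ))
      (Finset.filter_subset_filter (fun i => E.mulVec i = v) hBA)
    have h' : s ({i ∈ A | E.mulVec i = v} \ {i ∈ B | E.mulVec i = v}) ℓ +
      s {i ∈ B | E.mulVec i = v} ℓ = s {i ∈ A | E.mulVec i = v} ℓ := h
    rw [hA v ℓ, hB v ℓ, add_zero] at h'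
    rw [← h']
    congr 1
    ext i
    simp only [Finset.mem_filter, Finset.mem_sdiff]
    tauto
  obtain ⟨F, hF, hFS, hFP⟩ := exists_partition_minimal P hPsdiff S hPS
  refine ⟨F, hF, hFS, fun B hB => ?_⟩
  obtain ⟨hPB, hmin⟩ := hFP B hB
  have hconst : ∀ i ∈ B, ∀ i' ∈ B, E.mulVec i' = E.mulVec i := by
    intro i hi i' hi'
    have h := hmin {i' ∈ B | E.mulVec i' = E.mulVec i} (Finset.filter_subset _ _)
      ⟨i, by simp [hi]⟩ fun v ℓ => by
        rw [Finset.filter_filter]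
        by_cases hv : E.mulVec i = v
        · rw [← hPB v ℓ]
          congr 1
          ext
          simp [hv]
        · rw [Finset.filter_false_of_mem fun x _ hx => hv (hx.1.symm.trans hx.2)]
          exact Finset.sum_empty
    rw [← h] at hi'
    exact (Finset.mem_filter.1 hi').2
  have hPiff : ∀ A ⊆ B, (∀ ℓ, s A ℓ = 0) ↔ P A := by
    intro A hAB
    constructor
    · intro h v ℓ
      by_cases hv : ∀ i ∈ A, E.mulVec i = v
      · rw [Finset.filter_true_of_mem hv, h]
      · push Not at hv
        obtain ⟨i, hi, hiv⟩ := hv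
        rw [Finset.filter_false_of_mem fun x hx hxv =>
          hiv ((hconst x (hAB hx) i (hAB hi)).trans hxv)]
        exact Finset.sum_empty
    · intro h ℓ
      rcases A.eq_empty_or_nonempty with rfl | ⟨i, hi⟩
      · exact Finset.sum_empty
      · rw [← h (E.mulVec i) ℓ,
          Finset.filter_true_of_mem fun x hx => hconst i (hAB hi) x (hAB hx)]
  have hsB := (hPiff B subset_rfl).2 hPB
  refine ⟨hsB, fun i hi i' hi' => ⟨?_, ?_⟩⟩
  · rw [Matrix.mulVec_sub, hconst i' hi' i hi, sub_self]
  · have h := div_pow_primorial_card_eq_one B a (fun i => laurentMonomial ω i) hK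
      (fun i _ => by rw [← laurentMonomial_pow, hω, laurentMonomial_one]) hsB
      (fun A hAB hne hA => hmin A hAB hne ((hPiff A hAB).1 hA)) hi' hi
    have hBS : B.card ≤ S.card := Finset.card_le_card
      (hFS ▸ Finset.subset_biUnion_of_mem id hB)
    obtain ⟨c, hc⟩ : primorial B.card ∣ primorial S.card := primorial_dvd_primorial hBS
    rw [laurentMonomial_sub, hc, pow_mul, h, one_pow]

theorem exists_pos_pow_eq_one {n : ℕ} {ω : Fin n → ℂˣ} (hω : ∀ i, IsTorsionUnit (ω i)) :
    ∃ K : ℕ, 0 < K ∧ ω ^ K = 1 := by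
  choose c hc0 hc using hω
  refine ⟨∏ i, c i, Finset.prod_pos fun i _ => hc0 i, funext fun i => ?_⟩
  obtain ⟨e, he⟩ := Finset.dvd_prod_of_mem c (Finset.mem_univ i)
  rw [Pi.pow_apply, he, pow_mul, hc, one_pow, Pi.one_apply]

/-- Every maximal torsion coset of dimension `n - k` on a variety `V ⊆ G_m^n` defined over `ℚ`
by equations of total degree `d`, with exponent-vector set `S` of cardinality `N = S.card` and
diameter at most `D`, has an exponent `m * P_N` with `m ≤ D^(2k) k^(k/2)`, where `P_N` is the
primorial of `N`. -/
theorem exponent_of_maximal_torsion_coset (n L d : ℕ) (S : Finset (Fin n → ℤ))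
    (a : Fin L → (Fin n → ℤ) → ℚ)
    (hS : ∀ i, i ∈ S ↔ ∃ ℓ, a ℓ i ≠ 0)
    (hdeg : ∀ i ∈ S, (∀ j, 0 ≤ i j) ∧ (∑ j, i j) ≤ (d : ℤ))
    (D : ℝ)
    (hD : ∀ i ∈ S, ∀ i' ∈ S, Real.sqrt (∑ j, ((i j : ℝ) - (i' j : ℝ)) ^ 2) ≤ D)
    (V : Set (Fin n → ℂˣ))
    (hV : V = { x | ∀ ℓ, ∑ i ∈ S, (a ℓ i : ℂ) * ∏ j, (x j : ℂ) ^ (i j) = 0 })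
    (k : ℕ) (hk : k ≤ n) (C : Set (Fin n → ℂˣ))
    (hdim : IsTorsionCosetOfDim n (n - k) C)
    (hmax : IsMaximalTorsionCosetOf n C V) :
    ∃ m : ℕ, 0 < m ∧ (m : ℝ) ≤ D ^ (2 * k) * (k : ℝ) ^ ((k : ℝ) / 2) ∧
      IsExponentOf n (m * primorial S.card) C := by
  obtain ⟨ω, H, ⟨E, hE, hHE⟩, hω, hC⟩ := hdim
  change H = subtorus E at hHE
  subst hHE
  obtain ⟨K, hK, hωK⟩ := exists_pos_pow_eq_one hω
  have hmemV : ∀ x, x ∈ V ↔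
      ∀ ℓ, ∑ i ∈ S, (a ℓ i : ℂ) * (laurentMonomial x i : ℂ) = 0 := fun x => by
    simp [hV, laurentMonomial]
  obtain ⟨F, hF, hFS, hFP⟩ := exists_blocks S a E ω hK hωK fun h hh =>
    (hmemV _).1 (hmax.2.1 (hC ▸ ⟨h, hh, rfl⟩))
  obtain ⟨M, J, hM, hJ, hJc, hG⟩ := exists_matrix_det_ne_zero
    {u : Fin n → ℤ | ∃ B ∈ F, ∃ i ∈ B, ∃ i' ∈ B, u = i - i'}
  let E' : Matrix {j // j ∉ J} (Fin n) ℤ := Matrix.of fun j i => M.adjugate i j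
  have hE'u : ∀ u, E'.mulVec u = 0 ↔ ∀ j ∉ J, Matrix.vecMul u M.adjugate j = 0 := fun u => by
    have h : ∀ j, E'.mulVec u j = Matrix.vecMul u M.adjugate j := fun j => by
      simp [E', Matrix.mulVec, Matrix.vecMul, dotProduct, mul_comm]
    simp [funext_iff, h]
  have hdet : ∀ u, E'.mulVec u = 0 →
      M.det • u = ∑ i ∈ J, Matrix.vecMul u M.adjugate i • M i := fun u hu =>
    det_smul_eq_sum ((hE'u u).1 hu)
  have hEM : ∀ i ∈ J, E.mulVec (M i) = 0 ∧
      laurentMonomial ω (M i) ^ primorial S.card = 1 := fun i hi => by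
    obtain ⟨B, hB, u, hu, u', hu', h⟩ := hJ i hi
    rw [h]
    exact (hFP B hB).2 u hu u' hu'
  have hsub : subtorus E ⊆ subtorus E' := subtorus_subset fun u hu => by
    have h := congrArg E.mulVec (hdet u hu)
    rw [Matrix.mulVec_smul, Matrix.mulVec_sum, Finset.sum_eq_zero fun i hi => by
      rw [Matrix.mulVec_smul, (hEM i hi).1, smul_zero]] at h
    exact (smul_eq_zero.1 h).resolve_left hM
  have hrank : (E'.map (Int.cast : ℤ → ℚ)).rank = Fintype.card {j // j ∉ J} :=
    (linearIndependent_adjugate hM J).rank_matrix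
  have hTV : (fun h => ω * h) '' subtorus E' ⊆ V := by
    rintro _ ⟨h, hh, rfl⟩
    rw [hmemV]
    intro ℓ
    rw [← hFS, Finset.sum_biUnion hF]
    refine Finset.sum_eq_zero fun B hB => ?_
    rcases B.eq_empty_or_nonempty with rfl | ⟨i', hi'⟩
    · exact Finset.sum_empty
    have hb : ∀ i ∈ B, laurentMonomial h i = laurentMonomial h i' := fun i hi => by
      rw [← div_eq_one, ← laurentMonomial_sub]
      exact (mem_subtorus_iff E' h).1 hh _
        ((hE'u _).2 (hG _ ⟨B, hB, i, hi, i', hi', rfl⟩))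
    have h0 := congrArg (· * (laurentMonomial h i' : ℂ)) ((hFP B hB).1 ℓ)
    rw [← zero_mul (laurentMonomial h i' : ℂ)]
    refine Eq.trans ?_ h0
    rw [Finset.sum_mul]
    refine Finset.sum_congr rfl fun i hi => ?_
    simp only [laurentMonomial_mul, hb i hi, Units.val_mul, mul_assoc]
  have hCT : C = (fun h => ω * h) '' subtorus E' :=
    hmax.2.2 _ ⟨_, ω, _, isSubtorusOfDim_subtorus E' hrank rfl, hω, rfl⟩ hTV
      (hC ▸ Set.image_mono hsub)
  have hT : subtorus E = subtorus E' :=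
    Set.image_injective.2 (mul_right_injective ω) (hC.symm.trans hCT)
  have hcard : J.card = k := by
    have h1 := rank_le_of_subtorus_subset hT.subset
    have h2 := rank_le_of_subtorus_subset hT.symm.subset
    rw [hE, hrank, Fintype.card_subtype_compl, Fintype.card_fin, Fintype.card_coe] at h1 h2
    have := J.card_le_univ
    rw [Fintype.card_fin] at this
    omega
  refine ⟨M.det.natAbs, Int.natAbs_pos.2 hM, ?_, ω, subtorus E',
    ⟨_, isSubtorusOfDim_subtorus E' hrank rfl⟩, hω, hCT, ?_⟩
  · have hle : ((M.det.natAbs : ℕ) : ℝ) ≤ D ^ (2 * k) := by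
      rw [Nat.cast_natAbs, Int.cast_abs, ← hcard]
      refine abs_det_le_pow (fun i hi => ?_) hJc
      obtain ⟨B, hB, u, hu, u', hu', h⟩ := hJ i hi
      have hBS : B ⊆ S := hFS ▸ Finset.subset_biUnion_of_mem id hB
      have hsq := Real.sqrt_le_iff.1 (hD u (hBS hu) u' (hBS hu'))
      simpa [h] using hsq.2
    refine hle.trans (le_mul_of_one_le_right ((Nat.cast_nonneg _).trans hle) ?_)
    rcases Nat.eq_zero_or_pos k with rfl | hk0
    · simp
    · exact Real.one_le_rpow (by exact_mod_cast hk0) (by positivity)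
  · rw [mem_subtorus_iff]
    intro u hu
    have h : laurentMonomial (ω ^ primorial S.card) (M.det • u) = 1 := by
      rw [hdet u hu, laurentMonomial_sum]
      refine Finset.prod_eq_one fun i hi => ?_
      rw [laurentMonomial_smul, laurentMonomial_pow, (hEM i hi).2, one_zpow]
    rw [laurentMonomial_smul] at h
    rw [mul_comm, pow_mul, laurentMonomial_pow]
    rcases Int.natAbs_eq M.det with h' | h' <;> rw [h'] at h
    · simpa using h
    · simpa using h
end

section
/- Let V be an affine variety in G_m^n defined over ℚ by polynomial equations of total degree d, let N = #N(V) be the number of distinct exponent vectors occurring with nonzero coefficient among the defining equations, and let D(V) be the diameter of this set of exponent vectors in the Euclidean metric. Set K = P_N · lcm(1, 2, …, ⌊D(V)^{2n}·n^{n/2}⌋). Then K is an exponent of every maximal torsion coset of V. -/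
/-- A weighted power sum whose first `Θ.card` values vanish has all its weights zero. -/
theorem eq_zero_of_sum_mul_pow_eq_zero (Θ : Finset ℂ) (B : ℂ → ℂ)
    (h : ∀ k < Θ.card, ∑ θ ∈ Θ, B θ * θ ^ k = 0) : ∀ θ ∈ Θ, B θ = 0 := by
  intro θ hθ
  have hpos : 0 < Θ.card := Finset.card_pos.mpr ⟨θ, hθ⟩
  set f : Polynomial ℂ := ∏ x ∈ Θ.erase θ, (Polynomial.X - Polynomial.C x) with hf
  have hdeg : f.natDegree < Θ.card := by
    rw [hf, Polynomial.natDegree_finsetProd_X_sub_C_eq_card, Finset.card_erase_of_mem hθ]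
    omega
  have hsum : ∑ x ∈ Θ, B x * f.eval x = 0 := by
    simp_rw [Polynomial.eval_eq_sum_range' hdeg, Finset.mul_sum]
    rw [Finset.sum_comm]
    refine Finset.sum_eq_zero fun k hk => ?_
    have := h k (Finset.mem_range.mp hk)
    calc ∑ x ∈ Θ, B x * (f.coeff k * x ^ k) = f.coeff k * ∑ x ∈ Θ, B x * x ^ k := by
          rw [Finset.mul_sum]
          exact Finset.sum_congr rfl fun x _ => by ring
      _ = 0 := by rw [this, mul_zero]
  rw [Finset.sum_eq_single_of_mem θ hθ] at hsum
  · refine (mul_eq_zero.mp hsum).resolve_right ?_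
    rw [hf, Polynomial.eval_prod]
    refine Finset.prod_ne_zero_iff.mpr fun x hx => ?_
    simpa [sub_eq_zero] using (Finset.ne_of_mem_erase hx).symm
  · intro x hx hxθ
    have : f.eval x = 0 := by
      rw [hf, Polynomial.eval_prod]
      exact Finset.prod_eq_zero (Finset.mem_erase.mpr ⟨hxθ, hx⟩) (by simp)
    rw [this, mul_zero]

/-- A rational linear relation between `M`-th roots of unity is preserved by raising the roots of
unity to a power coprime to `M`. -/
theorem sum_mul_pow_eq_zero_of_coprime_s12 {ι : Type*} (T : Finset ι) (c : ι → ℚ) (ζ : ι → ℂ)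
    {M a : ℕ} (hM : 0 < M) (ha : a.Coprime M) (hζ : ∀ i ∈ T, ζ i ^ M = 1)
    (hsum : ∑ i ∈ T, (c i : ℂ) * ζ i = 0) : ∑ i ∈ T, (c i : ℂ) * ζ i ^ a = 0 := by
  have : NeZero M := ⟨hM.ne'⟩
  obtain ⟨z, hz⟩ : ∃ z : ℂ, IsPrimitiveRoot z M := ⟨_, Complex.isPrimitiveRoot_exp M hM.ne'⟩
  have hex : ∀ i, ∃ e : ℕ, i ∈ T → z ^ e = ζ i := by
    intro i
    by_cases hi : i ∈ T
    · obtain ⟨e, -, he⟩ := hz.eq_pow_of_pow_eq_one (hζ i hi)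
      exact ⟨e, fun _ => he⟩
    · exact ⟨0, fun h => absurd h hi⟩
  choose e he using hex
  set F : Polynomial ℚ := ∑ i ∈ T, Polynomial.C (c i) * Polynomial.X ^ e i with hF
  have haeval : ∀ w : ℂ, Polynomial.aeval w F = ∑ i ∈ T, (c i : ℂ) * w ^ e i := by
    intro w
    simp [hF]
  have h0 : Polynomial.aeval z F = 0 := by
    rw [haeval, ← hsum]
    exact Finset.sum_congr rfl fun i hi => by rw [he i hi]
  have hdvd : Polynomial.cyclotomic M ℚ ∣ F := by
    rw [Polynomial.cyclotomic_eq_minpoly_rat hz hM]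
    exact minpoly.dvd ℚ z h0
  have h1 : Polynomial.aeval (z ^ a) F = 0 := by
    refine Polynomial.aeval_eq_zero_of_dvd_aeval_eq_zero hdvd ?_
    rw [Polynomial.cyclotomic_eq_minpoly_rat (hz.pow_of_coprime a ha) hM]
    exact minpoly.aeval _ _
  rw [haeval] at h1
  rw [← h1]
  exact Finset.sum_congr rfl fun i hi => by rw [← he i hi, ← pow_mul, ← pow_mul, mul_comm a]

/-- A rational linear relation between `p * m`-th roots of unity splits along the cosets of the
group of `m`-th roots of unity when `p ∣ m` or when there are fewer than `p` terms. -/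
theorem sum_filter_pow_eq_zero_of_prime {ι : Type*} (T : Finset ι) (c : ι → ℚ) (ζ : ι → ℂ)
    {p m : ℕ} (hp : p.Prime) (hm : 0 < m) (hpm : p ∣ m ∨ T.card < p)
    (hζ : ∀ i ∈ T, ζ i ^ (p * m) = 1) (hsum : ∑ i ∈ T, (c i : ℂ) * ζ i = 0) (θ : ℂ) :
    ∑ i ∈ T with ζ i ^ m = θ, (c i : ℂ) * ζ i = 0 := by
  classical
  set Θ : Finset ℂ := T.image fun i => ζ i ^ m with hΘ
  have hcard : Θ.card ≤ T.card := Finset.card_image_le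
  have hpM : 0 < p * m := Nat.mul_pos hp.pos hm
  obtain ⟨s₁, hs₁⟩ : ∃ s₁ : ℕ, ∀ k < Θ.card, (1 + m * (s₁ + k)).Coprime (p * m) := by
    have hcop : ∀ s, ¬ p ∣ 1 + m * s → (1 + m * s).Coprime (p * m) := by
      intro s hs
      refine Nat.Coprime.mul_right (((Nat.Prime.coprime_iff_not_dvd hp).mpr hs).symm) ?_
      simp
    by_cases hdvd : p ∣ m
    · refine ⟨0, fun k _ => hcop _ fun h => hp.one_lt.ne' ?_⟩
      exact Nat.dvd_one.mp ((Nat.dvd_add_left (hdvd.mul_right _)).mp h)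
    · have hT : T.card < p := hpm.resolve_left hdvd
      by_cases hs : ∃ s₀, p ∣ 1 + m * s₀
      · obtain ⟨s₀, hs₀⟩ := hs
        refine ⟨s₀ + 1, fun k hk => hcop _ fun h => ?_⟩
        have h2 : 1 + m * (s₀ + 1 + k) = (1 + m * s₀) + m * (k + 1) := by ring
        rw [h2, Nat.dvd_add_right hs₀] at h
        rcases hp.dvd_mul.mp h with h | h
        · exact hdvd h
        · have := Nat.le_of_dvd (Nat.succ_pos k) h
          omega
      · exact ⟨0, fun k _ => hcop _ fun h => hs ⟨_, h⟩⟩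
  set A : ℂ → ℂ := fun x => ∑ i ∈ T with ζ i ^ m = x, (c i : ℂ) * ζ i with hA
  have key : ∀ x ∈ Θ, A x * x ^ s₁ = 0 := by
    refine eq_zero_of_sum_mul_pow_eq_zero Θ _ fun k hk => ?_
    have h3 := sum_mul_pow_eq_zero_of_coprime_s12 T c ζ hpM (hs₁ k hk) hζ hsum
    rw [← h3, ← Finset.sum_fiberwise_of_maps_to (g := fun i => ζ i ^ m) (t := Θ)
      fun i hi => Finset.mem_image_of_mem _ hi]
    refine Finset.sum_congr rfl fun x _ => ?_
    rw [hA, Finset.sum_mul, Finset.sum_mul]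
    refine Finset.sum_congr rfl fun i hi => ?_
    rw [← (Finset.mem_filter.mp hi).2]
    ring
  by_cases hθ : θ ∈ Θ
  · refine (mul_eq_zero.mp (key θ hθ)).resolve_right (pow_ne_zero _ ?_)
    obtain ⟨i, hi, rfl⟩ := Finset.mem_image.mp hθ
    refine pow_ne_zero _ fun h0 => ?_
    have := hζ i hi
    rw [h0, zero_pow hpM.ne'] at this
    exact zero_ne_one this
  · refine Finset.sum_eq_zero fun i hi => (hθ ?_).elim
    rw [Finset.mem_filter] at hi
    exact Finset.mem_image.mpr ⟨i, hi⟩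

/-- A number not dividing `P_N` is divisible by the square of a prime or by a prime above `N`. -/
theorem exists_prime_sq_dvd_or_lt_of_not_dvd_primorial {M N : ℕ}
    (h : ¬ M ∣ primorial N) : ∃ p m, p.Prime ∧ M = p * m ∧ (p ∣ m ∨ N < p) := by
  by_contra! hcon
  have hsq : Squarefree M := by
    rw [Nat.squarefree_iff_prime_squarefree]
    rintro p hp ⟨k, hk⟩
    exact (hcon p (p * k) hp (by rw [hk]; ring)).1 (dvd_mul_right _ _)
  refine h ?_
  rw [← Nat.prod_primeFactors_of_squarefree hsq]
  refine Finset.prod_dvd_prod_of_subset _ _ _ fun p hp => ?_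
  obtain ⟨hpp, ⟨m, hm⟩, -⟩ := Nat.mem_primeFactors.mp hp
  have := (hcon p m hpp hm).2
  exact Finset.mem_filter.mpr ⟨Finset.mem_range.mpr (by omega), hpp⟩

/-- **Mann's theorem**: a rational linear relation of length at most `N` between roots of unity
splits along the cosets of the group of `P_N`-th roots of unity. -/
theorem sum_filter_pow_primorial_eq_zero {ι : Type*} {N M : ℕ} (hM : 0 < M) (T : Finset ι)
    (hT : T.card ≤ N) (c : ι → ℚ) (ζ : ι → ℂ) (hζ : ∀ i ∈ T, ζ i ^ M = 1)
    (hsum : ∑ i ∈ T, (c i : ℂ) * ζ i = 0) (η : ℂ) :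
    ∑ i ∈ T with ζ i ^ primorial N = η, (c i : ℂ) * ζ i = 0 := by
  classical
  induction M using Nat.strong_induction_on generalizing T ζ η with
  | _ M ih =>
  by_cases hMP : M ∣ primorial N
  · obtain ⟨k, hk⟩ := hMP
    have h1 : ∀ i ∈ T, ζ i ^ primorial N = 1 := fun i hi => by
      rw [hk, pow_mul, hζ i hi, one_pow]
    by_cases hη : η = 1
    · rw [Finset.filter_true_of_mem fun i hi => by rw [h1 i hi, hη], hsum]
    · rw [Finset.filter_false_of_mem fun i hi => by rw [h1 i hi]; exact Ne.symm hη,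
        Finset.sum_empty]
  obtain ⟨p, m, hp, rfl, hpm⟩ := exists_prime_sq_dvd_or_lt_of_not_dvd_primorial hMP
  have hm : 0 < m := Nat.pos_of_mul_pos_left hM
  have hlt : m < p * m := (Nat.lt_mul_iff_one_lt_left hm).mpr hp.one_lt
  have hsplit := sum_filter_pow_eq_zero_of_prime T c ζ hp hm (hpm.imp_right hT.trans_lt) hζ hsum
  rw [← Finset.sum_fiberwise_of_maps_to (g := fun i => ζ i ^ m) (t := T.image fun i => ζ i ^ m)
      fun i hi => Finset.mem_image_of_mem _ (Finset.mem_filter.mp hi).1]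
  refine Finset.sum_eq_zero fun θ hθ => ?_
  obtain ⟨i₀, hi₀, rfl⟩ := Finset.mem_image.mp hθ
  have hz : ζ i₀ ≠ 0 := fun h0 => by
    have := hζ i₀ hi₀
    rw [h0, zero_pow hM.ne'] at this
    exact zero_ne_one this
  have hrel := ih m hlt hm {i ∈ T | ζ i ^ m = ζ i₀ ^ m}
    ((Finset.card_filter_le _ _).trans hT) (fun i => ζ i / ζ i₀)
    (fun i hi => by
      rw [div_pow, (Finset.mem_filter.mp hi).2, div_self (pow_ne_zero _ hz)])
    (by
      simp_rw [mul_div_assoc', ← Finset.sum_div]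
      rw [hsplit, zero_div])
    (η / ζ i₀ ^ primorial N)
  simp_rw [mul_div_assoc', ← Finset.sum_div] at hrel
  rw [div_eq_zero_iff, or_iff_left hz] at hrel
  rw [← hrel, Finset.filter_comm]
  refine Finset.sum_congr (Finset.filter_congr fun i _ => ?_) fun _ _ => rfl
  rw [div_pow, div_left_inj' (pow_ne_zero _ hz)]

/-- The value at the point `x` of `G_m^n` of the character with exponent vector `v`. -/
def torusChar {n : ℕ} (x : Fin n → ℂˣ) (v : Fin n → ℤ) : ℂˣ := ∏ j, x j ^ v j

theorem torusChar_zero {n : ℕ} (x : Fin n → ℂˣ) : torusChar x 0 = 1 := by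
  simp [torusChar]

theorem torusChar_add {n : ℕ} (x : Fin n → ℂˣ) (v w : Fin n → ℤ) :
    torusChar x (v + w) = torusChar x v * torusChar x w := by
  simp [torusChar, zpow_add, Finset.prod_mul_distrib]

theorem torusChar_sub {n : ℕ} (x : Fin n → ℂˣ) (v w : Fin n → ℤ) :
    torusChar x (v - w) = torusChar x v / torusChar x w := by
  simp [torusChar, zpow_sub, Finset.prod_mul_distrib, div_eq_mul_inv]

theorem torusChar_smul {n : ℕ} (x : Fin n → ℂˣ) (k : ℤ) (v : Fin n → ℤ) :
    torusChar x (k • v) = torusChar x v ^ k := by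
  simp [torusChar, mul_comm k, zpow_mul, Finset.prod_zpow]

theorem torusChar_single {n : ℕ} (x : Fin n → ℂˣ) (i : Fin n) :
    torusChar x (Pi.single i 1) = x i := by
  rw [torusChar, Finset.prod_eq_single_of_mem i (Finset.mem_univ i)]
  · simp
  · intro j _ hj
    simp [Pi.single_eq_of_ne hj]

theorem torusChar_mul {n : ℕ} (x y : Fin n → ℂˣ) (v : Fin n → ℤ) :
    torusChar (x * y) v = torusChar x v * torusChar y v := by
  simp [torusChar, mul_zpow, Finset.prod_mul_distrib]

theorem torusChar_pow {n : ℕ} (x : Fin n → ℂˣ) (k : ℕ) (v : Fin n → ℤ) :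
    torusChar (x ^ k) v = torusChar x v ^ k := by
  rw [torusChar, torusChar, ← Finset.prod_pow]
  exact Finset.prod_congr rfl fun j _ => by
    rw [Pi.pow_apply, ← zpow_natCast, ← zpow_natCast, ← zpow_mul, ← zpow_mul, mul_comm]

theorem torusChar_eq_of_forall_eq_prod {n r : ℕ} (E : Matrix (Fin r) (Fin n) ℤ)
    {x : Fin n → ℂˣ} {t : Fin r → ℂˣ} (h : ∀ i, x i = ∏ j, t j ^ E j i) (v : Fin n → ℤ) :
    torusChar x v = torusChar t (E.mulVec v) := by
  simp only [torusChar, h, Matrix.mulVec, dotProduct]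
  simp_rw [← Finset.prod_zpow, ← zpow_mul]
  rw [Finset.prod_comm]
  refine Finset.prod_congr rfl fun j _ => ?_
  induction (Finset.univ : Finset (Fin n)) using Finset.cons_induction with
  | empty => simp
  | cons a s ha ih => rw [Finset.prod_cons, Finset.sum_cons, zpow_add, ih]

theorem exists_zpow_eq_complex_units (u : ℂˣ) {k : ℤ} (hk : k ≠ 0) : ∃ w : ℂˣ, w ^ k = u := by
  have hnat : ∀ (m : ℕ), 0 < m → ∃ w : ℂˣ, w ^ m = u := fun m hm => by
    obtain ⟨z, hz⟩ := IsAlgClosed.exists_pow_nat_eq (u : ℂ) hm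
    have hz0 : z ≠ 0 := fun h0 => by
      rw [h0, zero_pow hm.ne'] at hz
      exact u.ne_zero hz.symm
    exact ⟨Units.mk0 z hz0, Units.ext (by simpa using hz)⟩
  obtain ⟨w, hw⟩ := hnat k.natAbs (Int.natAbs_pos.mpr hk)
  rcases Int.natAbs_eq k with h | h
  · exact ⟨w, by rw [h, zpow_natCast, hw]⟩
  · exact ⟨w⁻¹, by rw [h, zpow_neg, zpow_natCast, inv_pow, inv_inv, hw]⟩

/-- A point lies in the image of the torus parametrization given by `E` if and only if every
character that is trivial on that image is trivial at the point. -/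
theorem exists_eq_prod_zpow_iff {n r : ℕ} (E : Matrix (Fin r) (Fin n) ℤ) (x : Fin n → ℂˣ) :
    (∃ t : Fin r → ℂˣ, ∀ i, x i = ∏ j, t j ^ E j i) ↔
      ∀ v : Fin n → ℤ, E.mulVec v = 0 → torusChar x v = 1 := by
  constructor
  · rintro ⟨t, ht⟩ v hv
    rw [torusChar_eq_of_forall_eq_prod E ht, hv, torusChar_zero]
  · intro h
    let f : (Fin n → ℤ) →ₗ[ℤ] Additive ℂˣ :=
      { toFun := fun v => Additive.ofMul (torusChar x v)
        map_add' := fun v w => by rw [torusChar_add, ofMul_mul]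
        map_smul' := fun k v => by rw [torusChar_smul, ofMul_zpow]; rfl }
    have hker : LinearMap.ker E.mulVecLin ≤ LinearMap.ker f := fun v hv => by
      have := h v (by simpa using hv)
      rw [LinearMap.mem_ker]
      change Additive.ofMul (torusChar x v) = 0
      rw [this, ofMul_one]
    obtain ⟨g, hg⟩ := baer_additive_complex_units.extension_property
      ((LinearMap.ker E.mulVecLin).liftQ E.mulVecLin le_rfl)
      (LinearMap.ker_eq_bot.mp (Submodule.ker_liftQ_eq_bot _ _ _ le_rfl))
      ((LinearMap.ker E.mulVecLin).liftQ f hker)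
    have hgf : ∀ v, g (E.mulVec v) = f v := fun v => by
      have := LinearMap.congr_fun hg ((LinearMap.ker E.mulVecLin).mkQ v)
      simpa using this
    refine ⟨fun j => (g (Pi.single j 1)).toMul, fun i => ?_⟩
    have h1 := hgf (Pi.single i 1)
    have h2 : E.mulVec (Pi.single i 1) = ∑ j, E j i • (Pi.single j 1 : Fin r → ℤ) := by
      ext k
      simp [Matrix.mulVec_single, Finset.sum_apply, Pi.single_apply]
    have h3 : f (Pi.single i 1) = Additive.ofMul (x i) := by
      change Additive.ofMul (torusChar x _) = _
      rw [torusChar_single]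
    rw [h2, map_sum, h3] at h1
    simp_rw [map_smul] at h1
    rw [← toMul_ofMul (x i), ← h1, toMul_sum]
    rfl

/-- Every rational subspace is cut out by an integer matrix of full row rank. -/
theorem exists_matrix_mulVec_eq_zero_iff_mem {n : ℕ} (W : Submodule ℚ (Fin n → ℚ)) :
    ∃ (r : ℕ) (E : Matrix (Fin r) (Fin n) ℤ), (E.map (Int.cast : ℤ → ℚ)).rank = r ∧
      ∀ v : Fin n → ℤ, E.mulVec v = 0 ↔ (fun j => (v j : ℚ)) ∈ W := by
  let r := Module.finrank ℚ ((Fin n → ℚ) ⧸ W)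
  let e : ((Fin n → ℚ) ⧸ W) ≃ₗ[ℚ] (Fin r → ℚ) := (Module.finBasis ℚ _).equivFun
  let L : (Fin n → ℚ) →ₗ[ℚ] (Fin r → ℚ) := e.toLinearMap ∘ₗ W.mkQ
  have hLsurj : Function.Surjective L := e.surjective.comp W.mkQ_surjective
  have hLker : ∀ v, L v = 0 ↔ v ∈ W := fun v => by simp [L]
  let A : Matrix (Fin r) (Fin n) ℚ := LinearMap.toMatrix' L
  have hA : ∀ v, A.mulVec v = L v := fun v => LinearMap.toMatrix'_mulVec L v
  obtain ⟨b, hb⟩ := IsLocalization.exist_integer_multiples_of_finite (nonZeroDivisors ℤ)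
    (fun q : Fin r × Fin n => A q.1 q.2)
  have hb0 : ((b : ℤ) : ℚ) ≠ 0 := Int.cast_ne_zero.mpr (nonZeroDivisors.coe_ne_zero b)
  choose E hE using hb
  have hmap : (Matrix.of fun j i => E (j, i)).map (Int.cast : ℤ → ℚ) = ((b : ℤ) : ℚ) • A := by
    ext j i
    have := hE (j, i)
    simpa [Algebra.smul_def] using this
  refine ⟨r, Matrix.of fun j i => E (j, i), ?_, fun v => ?_⟩
  · rw [hmap, Matrix.rank]
    have htop : LinearMap.range (((b : ℤ) : ℚ) • A).mulVecLin = ⊤ := by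
      refine LinearMap.range_eq_top.mpr fun w => ?_
      obtain ⟨v, hv⟩ := hLsurj (((b : ℤ) : ℚ)⁻¹ • w)
      refine ⟨v, ?_⟩
      rw [Matrix.mulVecLin_apply, Matrix.smul_mulVec, hA, hv, smul_inv_smul₀ hb0]
    rw [htop, finrank_top, Module.finrank_fin_fun]
  · rw [← hLker, ← hA]
    have hcast : (fun k => (((Matrix.of fun j i => E (j, i)).mulVec v k : ℤ) : ℚ)) =
        ((b : ℤ) : ℚ) • A.mulVec fun j => (v j : ℚ) := by
      rw [← Matrix.smul_mulVec, ← hmap]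
      ext k
      simp [Matrix.mulVec, dotProduct]
    constructor
    · intro h
      refine (smul_eq_zero_iff_right hb0).mp (hcast ▸ ?_)
      ext k
      simp [h]
    · intro h
      rw [h, smul_zero] at hcast
      ext k
      exact Int.cast_injective ((congrFun hcast k).trans (by simp))

/-- **Hadamard's inequality** for the rows of a real matrix. -/
theorem abs_det_le_prod_sqrt {n : ℕ} (A : Matrix (Fin n) (Fin n) ℝ) :
    |A.det| ≤ ∏ i, Real.sqrt (∑ j, A i j ^ 2) := by
  have : Fact (Module.finrank ℝ (EuclideanSpace ℝ (Fin n)) = n) := ⟨by simp⟩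
  let b := EuclideanSpace.basisFun (Fin n) ℝ
  have h := b.toBasis.orientation.abs_volumeForm_apply_le fun i => WithLp.toLp 2 (A i)
  rw [Orientation.volumeForm_robust' _ b] at h
  have h1 : b.toBasis.det (fun i => WithLp.toLp 2 (A i)) = A.det := by
    rw [Module.Basis.det_apply, ← Matrix.det_transpose]
    congr 1
  rw [h1] at h
  simpa [EuclideanSpace.norm_eq] using h

/-- If `v` lies in the rational span of a set `Γ` of integer vectors of Euclidean norm at most `D`,
then some positive multiple of `v` by an integer at most `D ^ n` lies in the integral span. -/
theorem exists_smul_mem_span_int {n : ℕ} (Γ : Set (Fin n → ℤ)) {D : ℝ} (hD1 : 1 ≤ D)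
    (hD : ∀ u ∈ Γ, Real.sqrt (∑ j, (u j : ℝ) ^ 2) ≤ D) (v : Fin n → ℤ)
    (hv : (fun j => (v j : ℚ)) ∈
      Submodule.span ℚ ((fun (u : Fin n → ℤ) (j : Fin n) => (u j : ℚ)) '' Γ)) :
    ∃ m : ℕ, 0 < m ∧ (m : ℝ) ≤ D ^ n ∧ (m : ℤ) • v ∈ Submodule.span ℤ Γ := by
  set q : (Fin n → ℤ) → Fin n → ℚ := fun u j => (u j : ℚ) with hq
  have hqinj : Function.Injective q := fun u w h => by
    ext j
    exact Int.cast_injective (congrFun h j)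
  obtain ⟨s, hsΓ, hspan, hli⟩ := exists_linearIndependent ℚ (q '' Γ)
  let Γ' : Set (Fin n → ℤ) := Γ ∪ Set.range fun j => Pi.single j 1
  have hst : s ⊆ q '' Γ' := hsΓ.trans (Set.image_mono Set.subset_union_left)
  have htop : ⊤ ≤ Submodule.span ℚ (q '' Γ') := by
    rw [← (Pi.basisFun ℚ (Fin n)).span_eq]
    refine Submodule.span_mono ?_
    rintro _ ⟨j, rfl⟩
    refine ⟨Pi.single j 1, Or.inr ⟨j, rfl⟩, ?_⟩
    ext k
    simp [hq, Pi.single_apply]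
  have hs' : LinearIndepOn ℚ id s := hli
  let B₀ := Module.Basis.extendLe hs' hst htop
  have hfin : Finite (hs'.extend hst) := Module.Finite.finite_basis B₀
  have : Fintype (hs'.extend hst) := Fintype.ofFinite _
  have hcard : Fintype.card (hs'.extend hst) = n := by
    rw [← Module.finrank_eq_card_basis B₀, Module.finrank_fin_fun]
  let B := B₀.reindex (Fintype.equivFinOfCardEq hcard)
  have hBmem : ∀ i, B i ∈ q '' Γ' := fun i => by
    have : B i ∈ Set.range B₀ := by simp [B]
    rw [Module.Basis.range_extendLe] at this
    exact hs'.extend_subset hst this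
  have hsB : s ⊆ Set.range B := by
    rw [Module.Basis.range_reindex, Module.Basis.range_extendLe]
    exact hs'.subset_extend hst
  choose u hu huB using hBmem
  let A : Matrix (Fin n) (Fin n) ℤ := Matrix.of u
  have hsΓ' : ∀ i, B i ∈ s → u i ∈ Γ := fun i hi => by
    obtain ⟨w, hw, hwi⟩ := hsΓ hi
    rwa [hqinj ((huB i).trans hwi.symm)]
  have hrow : ∀ i, Real.sqrt (∑ j, (u i j : ℝ) ^ 2) ≤ D := fun i => by
    rcases hu i with h | ⟨k, hk⟩
    · exact hD _ h
    · rw [← hk]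
      simpa [Pi.single_apply, apply_ite, ite_pow] using hD1
  have hdet : A.det ≠ 0 := by
    have hrows : LinearIndependent ℚ (A.map (Int.castRingHom ℚ)).row := by
      have : (A.map (Int.castRingHom ℚ)).row = B := by
        ext i j
        rw [← huB i]
        rfl
      rw [this]
      exact B.linearIndependent
    rw [Matrix.linearIndependent_rows_iff_isUnit, Matrix.isUnit_iff_isUnit_det,
      isUnit_iff_ne_zero, ← RingHom.mapMatrix_apply, ← RingHom.map_det] at hrows
    intro h
    simp [h] at hrows
  let d : Fin n → ℤ := Matrix.vecMul v A.adjugate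
  have hd : A.det • v = ∑ i, d i • u i := by
    have : Matrix.vecMul d A = A.det • v := by
      rw [Matrix.vecMul_vecMul, Matrix.adjugate_mul, Matrix.vecMul_smul, Matrix.vecMul_one]
    rw [← this, Matrix.vecMul_eq_sum]
    rfl
  have hdQ : (A.det : ℚ) • q v = ∑ i, (d i : ℚ) • B i := by
    ext j
    have := congrFun hd j
    simp only [Pi.smul_apply, Finset.sum_apply, smul_eq_mul] at this ⊢
    simp_rw [← huB]
    simp only [hq]
    exact_mod_cast this
  have hd0 : ∀ i, B i ∉ s → d i = 0 := fun i hi => by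
    have hmem : (A.det : ℚ) • q v ∈ Submodule.span ℚ (B '' (B ⁻¹' s)) := by
      rw [Set.image_preimage_eq_of_subset hsB, hspan]
      exact Submodule.smul_mem _ _ hv
    have hsupp := Module.Basis.repr_support_subset_of_mem_span B _ hmem
    have hrepr : B.repr ((A.det : ℚ) • q v) i = d i := by
      rw [hdQ, Module.Basis.repr_sum_self]
    by_contra hne
    refine hi (hsupp (Finset.mem_coe.mpr (Finsupp.mem_support_iff.mpr ?_)))
    rw [hrepr]
    exact_mod_cast hne
  have hmem : A.det • v ∈ Submodule.span ℤ Γ := by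
    rw [hd]
    refine Submodule.sum_mem _ fun i _ => ?_
    by_cases hi : B i ∈ s
    · exact Submodule.smul_mem _ _ (Submodule.subset_span (hsΓ' i hi))
    · rw [hd0 i hi, zero_smul]
      exact Submodule.zero_mem _
  refine ⟨A.det.natAbs, Int.natAbs_pos.mpr hdet, ?_, ?_⟩
  · have h := abs_det_le_prod_sqrt (A.map (Int.castRingHom ℝ))
    rw [← RingHom.mapMatrix_apply, ← RingHom.map_det] at h
    rw [Nat.cast_natAbs, Int.cast_abs]
    refine h.trans ?_
    calc _ ≤ ∏ _i : Fin n, D :=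
          Finset.prod_le_prod (fun _ _ => Real.sqrt_nonneg _) fun i _ => hrow i
      _ = D ^ n := by simp
  · rcases Int.natAbs_eq A.det with h | h
    · rwa [← h]
    · rw [← neg_neg ((A.det.natAbs : ℤ)), ← h, neg_smul]
      exact Submodule.neg_mem _ hmem

/-- Distinct exponent vectors give distinct characters. -/
theorem torusChar_injective {n : ℕ} {v w : Fin n → ℤ}
    (h : ∀ t : Fin n → ℂˣ, torusChar t v = torusChar t w) : v = w := by
  classical
  ext j
  have h2 : (2 : ℂ) ≠ 0 := two_ne_zero
  have key : ∀ u : Fin n → ℤ,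
      torusChar (fun k => if k = j then Units.mk0 (2 : ℂ) h2 else 1) u =
        Units.mk0 (2 : ℂ) h2 ^ u j := fun u => by
    rw [torusChar, Finset.prod_eq_single_of_mem j (Finset.mem_univ j)]
    · simp
    · intro k _ hk
      simp [hk]
  have h3 := congrArg (fun z : ℂˣ => ‖(z : ℂ)‖) ((key v).symm.trans ((h _).trans (key w)))
  simp only [Units.val_zpow_eq_zpow_val, Units.val_mk0, norm_zpow, Complex.norm_ofNat] at h3
  exact zpow_right_injective₀ two_pos (by norm_num) h3

/-- Linear independence of the characters of a torus. -/
theorem sum_filter_eq_zero_of_sum_mul_torusChar {ι : Type*} {r : ℕ} (S : Finset ι)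
    (g : ι → Fin r → ℤ) (f : ι → ℂ)
    (h : ∀ t : Fin r → ℂˣ, ∑ i ∈ S, f i * (torusChar t (g i) : ℂ) = 0) (e : Fin r → ℤ) :
    ∑ i ∈ S with g i = e, f i = 0 := by
  classical
  let χ : (Fin r → ℤ) → ((Fin r → ℂˣ) →* ℂ) := fun v =>
    (Units.coeHom ℂ).comp
      { toFun := fun t => torusChar t v
        map_one' := by simp [torusChar]
        map_mul' := fun x y => torusChar_mul x y v }
  have hχ : Function.Injective χ := fun v w hvw =>
    torusChar_injective fun t => Units.ext (DFunLike.congr_fun hvw t)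
  have hli := (linearIndependent_monoidHom (Fin r → ℂˣ) ℂ).comp χ hχ
  rw [linearIndependent_iff'] at hli
  by_cases he : e ∈ S.image g
  · refine hli (S.image g) (fun e => ∑ i ∈ S with g i = e, f i) ?_ e he
    ext t
    rw [Finset.sum_apply, Pi.zero_apply, ← h t,
      ← Finset.sum_fiberwise_of_maps_to (g := g) (t := S.image g)
        fun i hi => Finset.mem_image_of_mem _ hi]
    refine Finset.sum_congr rfl fun e _ => ?_
    simp only [Pi.smul_apply, smul_eq_mul, Finset.sum_mul]
    refine Finset.sum_congr rfl fun i hi => ?_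
    rw [(Finset.mem_filter.mp hi).2]
    rfl
  · refine Finset.sum_eq_zero fun i hi => (he ?_).elim
    exact Finset.mem_image.mpr ⟨i, Finset.mem_filter.mp hi⟩

theorem isTorsionUnit_torusChar {n : ℕ} {ω : Fin n → ℂˣ} (hω : ∀ i, IsTorsionUnit (ω i)) :
    ∃ M : ℕ, 0 < M ∧ ∀ v : Fin n → ℤ, torusChar ω v ^ M = 1 := by
  choose k hk hωk using hω
  refine ⟨∏ i, k i, Finset.prod_pos fun i _ => hk i, fun v => ?_⟩
  rw [← torusChar_pow]
  have : ω ^ (∏ i, k i) = 1 := by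
    ext i
    obtain ⟨m, hm⟩ := Finset.dvd_prod_of_mem k (Finset.mem_univ i)
    rw [Pi.pow_apply, hm, pow_mul, hωk, one_pow, Pi.one_apply]
  rw [this]
  simp [torusChar]

/-- The differences of exponent vectors in `S` whose characters agree on the subtorus given by `E`
and take values at `ω` that differ by a `P`-th root of unity. -/
def linkedDifferences {n r : ℕ} (S : Finset (Fin n → ℤ)) (E : Matrix (Fin r) (Fin n) ℤ)
    (ω : Fin n → ℂˣ) (P : ℕ) : Set (Fin n → ℤ) :=
  { u | ∃ i ∈ S, ∃ k ∈ S, E.mulVec i = E.mulVec k ∧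
    torusChar ω i ^ P = torusChar ω k ^ P ∧ u = i - k }

/-- A Laurent polynomial with support in `S` vanishing on the coset of `ω` and the subtorus given
by `E` vanishes at `ω * h` for every `h` killed by the linked differences. -/
theorem sum_mul_torusChar_eq_zero_of_linkedDifferences {n r : ℕ} (S : Finset (Fin n → ℤ))
    (E : Matrix (Fin r) (Fin n) ℤ) {ω : Fin n → ℂˣ} (hω : ∀ i, IsTorsionUnit (ω i))
    (c : (Fin n → ℤ) → ℚ)
    (hvan : ∀ t : Fin r → ℂˣ,
      ∑ i ∈ S, ((c i : ℂ) * (torusChar ω i : ℂ)) * (torusChar t (E.mulVec i) : ℂ) = 0)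
    {h : Fin n → ℂˣ}
    (hh : ∀ u ∈ linkedDifferences S E ω (primorial S.card), torusChar h u = 1) :
    ∑ i ∈ S, (c i : ℂ) * (torusChar (ω * h) i : ℂ) = 0 := by
  classical
  obtain ⟨M, hM, hωM⟩ := isTorsionUnit_torusChar hω
  let b : (Fin n → ℤ) → (Fin r → ℤ) × ℂˣ :=
    fun i => (E.mulVec i, torusChar ω i ^ primorial S.card)
  rw [← Finset.sum_fiberwise_of_maps_to (g := b) (t := S.image b)
    fun i hi => Finset.mem_image_of_mem _ hi]
  refine Finset.sum_eq_zero fun y hy => ?_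
  obtain ⟨i₀, hi₀, rfl⟩ := Finset.mem_image.mp hy
  have hclass := sum_filter_eq_zero_of_sum_mul_torusChar S E.mulVec
    (fun i => (c i : ℂ) * (torusChar ω i : ℂ)) hvan (E.mulVec i₀)
  have hblock := sum_filter_pow_primorial_eq_zero hM {i ∈ S | E.mulVec i = E.mulVec i₀}
    (Finset.card_filter_le _ _) c (fun i => (torusChar ω i : ℂ))
    (fun i _ => by rw [← Units.val_pow_eq_pow_val, hωM i, Units.val_one]) hclass
    ((torusChar ω i₀ : ℂ) ^ primorial S.card)
  rw [Finset.filter_filter] at hblock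
  have hfilter : {i ∈ S | b i = b i₀} = {i ∈ S | E.mulVec i = E.mulVec i₀ ∧
      (torusChar ω i : ℂ) ^ primorial S.card = (torusChar ω i₀ : ℂ) ^ primorial S.card} :=
    Finset.filter_congr fun i _ => by
      simp only [b, Prod.mk.injEq, Units.ext_iff, Units.val_pow_eq_pow_val]
  rw [← hfilter] at hblock
  calc ∑ i ∈ S with b i = b i₀, (c i : ℂ) * (torusChar (ω * h) i : ℂ)
      = ∑ i ∈ S with b i = b i₀, ((c i : ℂ) * (torusChar ω i : ℂ)) * (torusChar h i₀ : ℂ) := by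
        refine Finset.sum_congr rfl fun i hi => ?_
        obtain ⟨hiS, hib⟩ := Finset.mem_filter.mp hi
        obtain ⟨h1, h2⟩ := Prod.mk.inj hib
        have h3 := hh (i - i₀) ⟨i, hiS, i₀, hi₀, h1, h2, rfl⟩
        rw [torusChar_sub, div_eq_one] at h3
        rw [torusChar_mul, h3, Units.val_mul, mul_assoc]
    _ = 0 := by rw [← Finset.sum_mul, hblock, zero_mul]

/-- A torsion point whose `P`-th power is killed by all elements of `Γ` is killed, after raising to
the power `P * lcm (1, …, B)`, by every integer vector in the rational span of `Γ`. -/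
theorem torusChar_pow_mul_lcm_eq_one {n P : ℕ} {D : ℝ} (Γ : Set (Fin n → ℤ))
    (hD : ∀ u ∈ Γ, Real.sqrt (∑ j, (u j : ℝ) ^ 2) ≤ D) (ω : Fin n → ℂˣ)
    (hω : ∀ u ∈ Γ, torusChar ω u ^ P = 1) (v : Fin n → ℤ)
    (hv : (fun j => (v j : ℚ)) ∈
      Submodule.span ℚ ((fun (u : Fin n → ℤ) (j : Fin n) => (u j : ℚ)) '' Γ)) :
    torusChar ω v ^ (P * (Finset.Icc 1 ⌊D ^ (2 * n) * (n : ℝ) ^ ((n : ℝ) / 2)⌋₊).lcm id) = 1 := by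
  by_cases hΓ : ∀ u ∈ Γ, u = 0
  · have hv0 : v = 0 := by
      have hbot : Submodule.span ℚ ((fun (u : Fin n → ℤ) (j : Fin n) => (u j : ℚ)) '' Γ) = ⊥ := by
        rw [Submodule.span_eq_bot]
        rintro _ ⟨u, hu, rfl⟩
        ext j
        simp [hΓ u hu]
      rw [hbot, Submodule.mem_bot] at hv
      ext j
      exact Int.cast_injective ((congrFun hv j).trans (by simp))
    rw [hv0, torusChar_zero, one_pow]
  push Not at hΓ
  obtain ⟨u, hu, hu0⟩ := hΓ
  obtain ⟨j, hj⟩ := Function.ne_iff.mp hu0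
  have hn : 1 ≤ n := Nat.one_le_of_lt j.isLt
  have hD1 : 1 ≤ D := by
    refine le_trans (Real.one_le_sqrt.mpr ?_) (hD u hu)
    have h1 : (1 : ℝ) ≤ (u j : ℝ) ^ 2 := by
      have : (1 : ℤ) ≤ u j ^ 2 := Int.add_one_le_iff.mpr (sq_pos_of_ne_zero hj)
      exact_mod_cast this
    exact h1.trans (Finset.single_le_sum (f := fun j => (u j : ℝ) ^ 2)
      (fun _ _ => sq_nonneg _) (Finset.mem_univ j))
  obtain ⟨m, hm0, hmD, hmem⟩ := exists_smul_mem_span_int Γ hD1 hD v hv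
  have hmdvd : m ∣ (Finset.Icc 1 ⌊D ^ (2 * n) * (n : ℝ) ^ ((n : ℝ) / 2)⌋₊).lcm id := by
    refine Finset.dvd_lcm (f := id) (Finset.mem_Icc.mpr ⟨hm0, Nat.le_floor ?_⟩)
    have h1 : (1 : ℝ) ≤ (n : ℝ) ^ ((n : ℝ) / 2) :=
      Real.one_le_rpow (by exact_mod_cast hn) (by positivity)
    have h2 : D ^ n ≤ D ^ (2 * n) := pow_le_pow_right₀ hD1 (by omega)
    have h3 : 0 ≤ D ^ (2 * n) := by positivity
    nlinarith
  obtain ⟨q, hq⟩ := hmdvd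
  have hspan : ∀ w ∈ Submodule.span ℤ Γ, torusChar ω w ^ P = 1 := fun w hw => by
    induction hw using Submodule.span_induction with
    | mem w hw => exact hω w hw
    | zero => rw [torusChar_zero, one_pow]
    | add x y _ _ hx hy => rw [torusChar_add, mul_pow, hx, hy, one_mul]
    | smul k x _ hx =>
      rw [torusChar_smul, ← zpow_natCast, zpow_comm, zpow_natCast, hx, one_zpow]
  have h4 := hspan _ hmem
  rw [torusChar_smul, zpow_natCast, ← pow_mul] at h4
  rw [hq, ← mul_assoc, pow_mul, mul_comm P m, h4, one_pow]

/-- Killer exponent: for a variety `V ⊆ G_m^n` defined over `ℚ` by equations of total degree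
`d`, with exponent-vector set `S` (so `N = S.card`) of diameter at most `D`, the number
`K = P_N * lcm(1, …, ⌊D^(2n) n^(n/2)⌋)` is an exponent of every maximal torsion coset of `V`. -/
theorem killer_exponent_of_variety (n L d : ℕ) (S : Finset (Fin n → ℤ))
    (a : Fin L → (Fin n → ℤ) → ℚ)
    (hS : ∀ i, i ∈ S ↔ ∃ ℓ, a ℓ i ≠ 0)
    (hdeg : ∀ i ∈ S, (∀ j, 0 ≤ i j) ∧ (∑ j, i j) ≤ (d : ℤ))
    (D : ℝ)
    (hD : ∀ i ∈ S, ∀ i' ∈ S, Real.sqrt (∑ j, ((i j : ℝ) - (i' j : ℝ)) ^ 2) ≤ D)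
    (V : Set (Fin n → ℂˣ))
    (hV : V = { x | ∀ ℓ, ∑ i ∈ S, (a ℓ i : ℂ) * ∏ j, (x j : ℂ) ^ (i j) = 0 })
    (K : ℕ)
    (hK : K = primorial S.card *
      (Finset.Icc 1 ⌊D ^ (2 * n) * (n : ℝ) ^ ((n : ℝ) / 2)⌋₊).lcm id) :
    ∀ C : Set (Fin n → ℂˣ), IsMaximalTorsionCosetOf n C V → IsExponentOf n K C := by
  rintro C ⟨⟨r, ω, H, ⟨E, hE, hH⟩, hω, hC⟩, hCV, hmax⟩
  set Γ := linkedDifferences S E ω (primorial S.card)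
  obtain ⟨r', E', hE', hker⟩ := exists_matrix_mulVec_eq_zero_iff_mem
    (Submodule.span ℚ ((fun (u : Fin n → ℤ) (j : Fin n) => (u j : ℚ)) '' Γ))
  set H' : Set (Fin n → ℂˣ) := { x | ∃ t : Fin r' → ℂˣ, ∀ i, x i = ∏ j, t j ^ E' j i } with hH'
  have hH'sub : IsSubtorusOfDim n r' H' := ⟨E', hE', rfl⟩
  have hvalue : ∀ (x : Fin n → ℂˣ) (i : Fin n → ℤ),
      (torusChar x i : ℂ) = ∏ j, (x j : ℂ) ^ i j := fun x i => by
    simp [torusChar, Units.coe_prod, Units.val_zpow_eq_zpow_val]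
  have hHH' : H ⊆ H' := by
    intro x hx
    rw [hH']
    refine (exists_eq_prod_zpow_iff E' x).mpr fun v hv => ?_
    rw [hH] at hx
    refine (exists_eq_prod_zpow_iff E x).mp hx v ?_
    have hle : Submodule.span ℚ ((fun (u : Fin n → ℤ) (j : Fin n) => (u j : ℚ)) '' Γ) ≤
        LinearMap.ker (E.map (Int.cast : ℤ → ℚ)).mulVecLin := by
      rw [Submodule.span_le]
      rintro _ ⟨_, ⟨i, -, i', -, hii', -, rfl⟩, rfl⟩
      have h0 : E.mulVec (i - i') = 0 := by rw [Matrix.mulVec_sub, hii', sub_self]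
      refine LinearMap.mem_ker.mpr ?_
      ext k
      have := congrArg (Int.cast : ℤ → ℚ) (congrFun h0 k)
      simpa [Matrix.mulVec, dotProduct] using this
    have hv' := LinearMap.mem_ker.mp (hle ((hker v).mp hv))
    ext k
    have := congrFun hv' k
    refine Int.cast_injective (α := ℚ) ?_
    simpa [Matrix.mulVec, dotProduct] using this
  have hcosetV : (fun h => ω * h) '' H' ⊆ V := by
    rintro _ ⟨h, hh, rfl⟩
    rw [hV]
    intro ℓ
    simp_rw [← hvalue]
    refine sum_mul_torusChar_eq_zero_of_linkedDifferences S E hω (a ℓ) (fun t => ?_)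
      fun u hu => (exists_eq_prod_zpow_iff E' h).mp hh u
        ((hker u).mpr (Submodule.subset_span ⟨u, hu, rfl⟩))
    have hmem : ω * (fun i => ∏ j, t j ^ E j i) ∈ V := by
      refine hCV ?_
      rw [hC, hH]
      exact ⟨_, ⟨t, fun _ => rfl⟩, rfl⟩
    rw [hV] at hmem
    rw [← hmem ℓ]
    refine Finset.sum_congr rfl fun i _ => ?_
    rw [← hvalue, torusChar_mul, torusChar_eq_of_forall_eq_prod E (fun _ => rfl), Units.val_mul,
      mul_assoc]
  have hCC' : C = (fun h => ω * h) '' H' :=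
    hmax _ ⟨r', ω, H', hH'sub, hω, rfl⟩ hcosetV (hC ▸ Set.image_mono hHH')
  refine ⟨ω, H', ⟨r', hH'sub⟩, hω, hCC', ?_⟩
  refine (exists_eq_prod_zpow_iff E' _).mpr fun v hv => ?_
  rw [torusChar_pow, hK]
  refine torusChar_pow_mul_lcm_eq_one Γ ?_ ω ?_ v ((hker v).mp hv)
  · rintro _ ⟨i, hi, i', hi', -, -, rfl⟩
    simpa using hD i hi i' hi'
  · rintro _ ⟨i, -, i', -, -, hpow, rfl⟩
    rw [torusChar_sub, div_pow, hpow, div_self']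
end

section
/- Let h(x_0, x_1, …, x_n) = 2(x_0² − 1)·∏_{i=1}^{n}(x_i − 1) − x_0·Σ_{j=1}^{n}(x_j + 1)·∏_{i≠j}(x_i − 1), defining a hypersurface h = 0 in G_m^{n+1}. Then there exists a positive integer K that is an exponent of every maximal torsion coset of this hypersurface, satisfying log log K < 0.2 + (3(n+1)/2)·log(n+3); moreover K can be chosen so that all of its prime factors are less than (n+3)^{3(n+1)/2}. -/
open Polynomial in
theorem IsPrimitiveRoot.aeval_pow_eq_zero_of_coprime {m : ℕ} (hm : 0 < m) {ζ : ℂ}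
    (hζ : IsPrimitiveRoot ζ m) {a : ℕ} (ha : a.Coprime m) {P : ℚ[X]} (hP : aeval ζ P = 0) :
    aeval (ζ ^ a) P = 0 := by
  have h := minpoly.dvd ℚ ζ hP
  rw [← cyclotomic_eq_minpoly_rat hζ hm,
    cyclotomic_eq_minpoly_rat (hζ.pow_of_coprime a ha) hm] at h
  exact aeval_eq_zero_of_dvd_aeval_eq_zero h (minpoly.aeval ℚ _)

theorem IsPrimitiveRoot.sum_conj_eq_zero {ι : Type*} {B : Finset ι} {a : ι → ℚ} {e : ι → ℕ}
    {m : ℕ} (hm : 0 < m) {ζ : ℂ} (hζ : IsPrimitiveRoot ζ m) {k : ℕ} (hk : k.Coprime m)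
    (h : ∑ i ∈ B, (a i : ℂ) * ζ ^ e i = 0) : ∑ i ∈ B, (a i : ℂ) * (ζ ^ k) ^ e i = 0 := by
  have := hζ.aeval_pow_eq_zero_of_coprime hm hk
    (P := ∑ i ∈ B, Polynomial.C (a i) * Polynomial.X ^ e i) (by simpa [map_sum] using h)
  simpa [map_sum] using this

theorem Nat.Prime.exists_forall_coprime_one_add_mul {p q : ℕ} (hp : p.Prime) :
    ∃ j₀ < p, ∀ j < p, j ≠ j₀ → (1 + j * q).Coprime (q * p) := by
  have key : ∀ j, ¬ p ∣ 1 + j * q → (1 + j * q).Coprime (q * p) := fun j hj =>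
    Nat.Coprime.mul_right (by simp) ((hp.coprime_iff_not_dvd.2 hj).symm)
  by_cases hex : ∃ j₀ < p, p ∣ 1 + j₀ * q
  · obtain ⟨j₀, hj₀, hd₀⟩ := hex
    refine ⟨j₀, hj₀, fun j hj hne => key j fun hd => hne ?_⟩
    have hq : IsCoprime (p : ℤ) q := by
      rw [Nat.isCoprime_iff_coprime, hp.coprime_iff_not_dvd]
      intro hpq
      have := (Nat.dvd_add_left (hpq.mul_left j₀)).1 hd₀
      exact hp.one_lt.ne' (Nat.dvd_one.1 this)
    have h1 : (p : ℤ) ∣ (j - j₀) * q := by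
      have h : (p : ℤ) ∣ 1 + j * q := mod_cast hd
      have h₀ : (p : ℤ) ∣ 1 + j₀ * q := mod_cast hd₀
      have h' := _root_.dvd_sub h h₀
      rwa [add_sub_add_left_eq_sub, ← sub_mul] at h'
    have h2 := hq.dvd_of_dvd_mul_right h1
    have h3 := Int.eq_zero_of_abs_lt_dvd h2 (by rw [abs_lt]; constructor <;> omega)
    omega
  · push Not at hex
    exact ⟨0, hp.pos, fun j hj _ => key j (hex j hj)⟩

theorem IsPrimitiveRoot.sum_div_pow_eq {p : ℕ} {ξ : ℂ} (hξ : IsPrimitiveRoot ξ p)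
    {s : ℕ} (hs : s < p) (e : ℕ) :
    ∑ j ∈ Finset.range p, (ξ ^ e / ξ ^ s) ^ j = if e % p = s then (p : ℂ) else 0 := by
  have hξ0 : ξ ≠ 0 := hξ.ne_zero (by omega)
  have hmod : ξ ^ e = ξ ^ (e % p) := by
    conv_lhs => rw [← Nat.mod_add_div e p, pow_add, pow_mul, hξ.pow_eq_one]
    simp
  split_ifs with h
  · rw [hmod, h, div_self (pow_ne_zero _ hξ0)]
    simp
  · have hne : ξ ^ e / ξ ^ s ≠ 1 := by
      rw [Ne, div_eq_one_iff_eq (pow_ne_zero _ hξ0), hmod]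
      exact fun h' => h (hξ.pow_inj (Nat.mod_lt _ (by omega)) hs h')
    rw [geom_sum_eq hne, div_pow, ← pow_mul, ← pow_mul, mul_comm e, mul_comm s, pow_mul, pow_mul,
      hξ.pow_eq_one]
    simp

theorem IsPrimitiveRoot.sum_filter_mod_eq_zero {ι : Type*} {B : Finset ι} {a : ι → ℚ} {e : ι → ℕ}
    {q p : ℕ} (hp : p.Prime) (hq : 0 < q) {ζ : ℂ} (hζ : IsPrimitiveRoot ζ (q * p))
    (h : ∑ i ∈ B, (a i : ℂ) * ζ ^ e i = 0) (hqp : p ∣ q ∨ B.card < p) {s : ℕ} (hs : s < p) :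
    ∑ i ∈ B with e i % p = s, (a i : ℂ) * ζ ^ e i = 0 := by
  have hm : 0 < q * p := Nat.mul_pos hq hp.pos
  have hξ : IsPrimitiveRoot (ζ ^ q) p := hζ.pow hm rfl
  set ξ := ζ ^ q
  set g : ℕ → ℂ := fun j => ∑ i ∈ B, (a i : ℂ) * ζ ^ e i * (ξ ^ e i) ^ j
  have hg : ∀ j, (1 + j * q).Coprime (q * p) → g j = 0 := fun j hj => by
    rw [← hζ.sum_conj_eq_zero hm hj h]
    refine Finset.sum_congr rfl fun i _ => ?_
    simp only [ξ]
    ring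
  obtain ⟨j₀, hj₀, hcop⟩ := hp.exists_forall_coprime_one_add_mul (q := q)
  have hinv : ∀ s < p, ∑ i ∈ B with e i % p = s, (a i : ℂ) * ζ ^ e i =
      (p : ℂ)⁻¹ * ((ξ ^ s)⁻¹ ^ j₀ * g j₀) := by
    intro s hs
    have hp0 : (p : ℂ) ≠ 0 := Nat.cast_ne_zero.2 hp.ne_zero
    rw [← Finset.sum_eq_single (s := Finset.range p) (f := fun j => (ξ ^ s)⁻¹ ^ j * g j) j₀
      (fun j hj hne => by rw [hg j (hcop j (Finset.mem_range.1 hj) hne), mul_zero])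
      (fun h => absurd (Finset.mem_range.2 hj₀) h)]
    simp only [g, Finset.mul_sum]
    rw [Finset.sum_comm, Finset.sum_filter]
    refine Finset.sum_congr rfl fun i _ => ?_
    have : ∀ j ∈ Finset.range p, (p : ℂ)⁻¹ * ((ξ ^ s)⁻¹ ^ j * (a i * ζ ^ e i * (ξ ^ e i) ^ j)) =
        (p : ℂ)⁻¹ * (a i * ζ ^ e i) * (ξ ^ e i / ξ ^ s) ^ j := fun j _ => by
      rw [div_eq_mul_inv, mul_pow]
      ring
    rw [Finset.sum_congr rfl this, ← Finset.mul_sum, hξ.sum_div_pow_eq hs]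
    split_ifs
    · field_simp
    · simp
  have hg₀ : g j₀ = 0 := by
    rcases hqp with hpq | hcard
    · refine hg j₀ (Nat.Coprime.mul_right (by simp) ?_)
      obtain ⟨c, rfl⟩ := hpq
      rw [mul_left_comm]
      simp
    · obtain ⟨s₀, hs₀, hn⟩ := Finset.exists_mem_notMem_of_card_lt_card
        (s := B.image fun i => e i % p) (t := Finset.range p)
        (by simpa using Finset.card_image_le.trans_lt hcard)
      have h0 := hinv s₀ (Finset.mem_range.1 hs₀)
      rw [Finset.filter_eq_empty_iff.2
        (fun i hi he => hn (Finset.mem_image.2 ⟨i, hi, he⟩)), Finset.sum_empty] at h0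
      have hξ0 : ξ ≠ 0 := hξ.ne_zero hp.ne_zero
      simpa [hp.ne_zero, hξ0] using h0.symm
  rw [hinv s hs, hg₀]
  simp

/-- A family has *minimal zero sum* on `B` if `B` is nonempty, its sum over `B` vanishes, and
no sum over a nonempty proper subset vanishes. -/
def MinimalZeroSum {ι : Type*} (f : ι → ℂ) (B : Finset ι) : Prop :=
  B.Nonempty ∧ ∑ i ∈ B, f i = 0 ∧ ∀ A ⊆ B, A.Nonempty → ∑ i ∈ A, f i = 0 → A = B

theorem Nat.dvd_factorial_of_squarefree {m k : ℕ} (hm : Squarefree m)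
    (h : ∀ p, p.Prime → p ∣ m → p ≤ k) : m ∣ k.factorial := by
  rw [← Nat.prod_primeFactors_of_squarefree hm]
  refine Finset.prod_primes_dvd _ (fun p hp => (Nat.prime_of_mem_primeFactors hp).prime)
    fun p hp => ?_
  have hp' := Nat.prime_of_mem_primeFactors hp
  exact Nat.dvd_factorial hp'.pos (h p hp' (Nat.dvd_of_mem_primeFactors hp))

theorem MinimalZeroSum.pow_factorial_eq_one {ι : Type*} {B : Finset ι} {a : ι → ℚ} {ζ : ι → ℂ}
    (hB : MinimalZeroSum (fun i => (a i : ℂ) * ζ i) B) {k : ℕ} (hk : 0 < k)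
    (hζ : ∀ i ∈ B, ζ i ^ k = 1) {i₀ : ι} (hi₀ : i₀ ∈ B) (h1 : ζ i₀ = 1) {i : ι} (hi : i ∈ B) :
    ζ i ^ B.card.factorial = 1 := by
  classical
  have hex : ∃ m, 0 < m ∧ ∀ i ∈ B, ζ i ^ m = 1 := ⟨k, hk, hζ⟩
  obtain ⟨m, ⟨hm0, hm⟩, hmin⟩ : ∃ m, (0 < m ∧ ∀ i ∈ B, ζ i ^ m = 1) ∧
      ∀ m' < m, ¬ (0 < m' ∧ ∀ i ∈ B, ζ i ^ m' = 1) :=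
    ⟨Nat.find hex, Nat.find_spec hex, fun _ => Nat.find_min hex⟩
  have hz := Complex.isPrimitiveRoot_exp m hm0.ne'
  set z := Complex.exp (2 * Real.pi * Complex.I / m)
  have : NeZero m := ⟨hm0.ne'⟩
  choose! e he using fun i (hi : i ∈ B) => hz.eq_pow_of_pow_eq_one (hm i hi)
  have hsum : ∀ A ⊆ B, ∑ i ∈ A, (a i : ℂ) * ζ i = ∑ i ∈ A, (a i : ℂ) * z ^ e i := fun A hA =>
    Finset.sum_congr rfl fun i hi => by rw [(he i (hA hi)).2]
  have key : ∀ p q : ℕ, p.Prime → m = q * p → ¬ (p ∣ q ∨ B.card < p) := by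
    intro p q hp hmq hor
    have hq : 0 < q := Nat.pos_of_ne_zero fun h => by simp [h] at hmq; omega
    have h0 := (hmq ▸ hz).sum_filter_mod_eq_zero hp hq ((hsum B subset_rfl).symm.trans hB.2.1)
      hor hp.pos
    rw [← hsum _ (Finset.filter_subset _ _)] at h0
    have hdvd : p ∣ e i₀ := by
      refine dvd_trans ⟨q, by rw [hmq, mul_comm]⟩ (hz.dvd_of_pow_eq_one (e i₀) ?_)
      rw [(he i₀ hi₀).2, h1]
    have hall := hB.2.2 _ (Finset.filter_subset _ _)
      ⟨i₀, Finset.mem_filter.2 ⟨hi₀, Nat.mod_eq_zero_of_dvd hdvd⟩⟩ h0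
    refine hmin q ?_ ⟨hq, fun i hi => ?_⟩
    · rw [hmq]
      exact lt_mul_of_one_lt_right hq hp.one_lt
    · rw [← hall, Finset.mem_filter] at hi
      obtain ⟨c, hc⟩ := Nat.dvd_of_mod_eq_zero hi.2
      rw [← (he i hi.1).2, hc, ← pow_mul, mul_right_comm, mul_comm p q, ← hmq, pow_mul,
        hz.pow_eq_one, one_pow]
  obtain ⟨c, hc⟩ : m ∣ B.card.factorial := by
    refine Nat.dvd_factorial_of_squarefree ?_ fun p hp ⟨q, hpq⟩ => ?_
    · rw [Nat.squarefree_iff_prime_squarefree]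
      rintro p hp ⟨q, hpq⟩
      exact key p (p * q) hp (by rw [hpq]; ring) (Or.inl ⟨q, rfl⟩)
    · by_contra! hlt
      exact key p q hp (by rw [hpq, mul_comm]) (Or.inr hlt)
  rw [hc, pow_mul, hm i hi, one_pow]

/-- **Mann's theorem** on minimal vanishing sums of roots of unity. -/
theorem MinimalZeroSum.pow_factorial_eq {ι : Type*} {B : Finset ι} {a : ι → ℚ} {ζ : ι → ℂˣ}
    (hB : MinimalZeroSum (fun i => (a i : ℂ) * ζ i) B) {k : ℕ} (hk : 0 < k)
    (hζ : ∀ i ∈ B, ζ i ^ k = 1) {i j : ι} (hi : i ∈ B) (hj : j ∈ B) :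
    ζ i ^ B.card.factorial = ζ j ^ B.card.factorial := by
  have hsum : ∀ A : Finset ι, ∑ i ∈ A, (a i : ℂ) * ((ζ i : ℂ) / ζ j) =
      (∑ i ∈ A, (a i : ℂ) * ζ i) / ζ j := fun A => by
    rw [Finset.sum_div]
    exact Finset.sum_congr rfl fun i _ => by ring
  have hB' : MinimalZeroSum (fun i => (a i : ℂ) * ((ζ i : ℂ) / ζ j)) B := by
    refine ⟨hB.1, by rw [hsum, hB.2.1, zero_div], fun A hA hne h0 => hB.2.2 A hA hne ?_⟩
    rw [hsum] at h0
    simpa using h0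
  have := hB'.pow_factorial_eq_one hk (fun i hi => by
    rw [div_pow]; norm_cast; simp [hζ i hi, hζ j hj]) hj (div_self (ζ j).ne_zero) hi
  rw [div_pow, div_eq_one_iff_eq (pow_ne_zero _ (ζ j).ne_zero)] at this
  exact_mod_cast this

/-- The value at `x` of the Laurent monomial with exponent vector `m`. -/
def monomialEval {n : ℕ} (x : Fin n → ℂˣ) (m : Fin n → ℤ) : ℂˣ := ∏ i, x i ^ m i

section monomialEval

variable {n : ℕ}

theorem monomialEval_mul (x y : Fin n → ℂˣ) (m : Fin n → ℤ) :
    monomialEval (x * y) m = monomialEval x m * monomialEval y m := by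
  simp [monomialEval, mul_zpow, Finset.prod_mul_distrib]

theorem monomialEval_pow (x : Fin n → ℂˣ) (k : ℕ) (m : Fin n → ℤ) :
    monomialEval (x ^ k) m = monomialEval x m ^ k := by
  rw [monomialEval, monomialEval, ← Finset.prod_pow]
  refine Finset.prod_congr rfl fun i _ => ?_
  rw [Pi.pow_apply, ← zpow_natCast, ← zpow_natCast, zpow_comm]

/-- `monomialEval` as a linear map in the exponent vector. -/
def monomialEvalLinear (x : Fin n → ℂˣ) : (Fin n → ℤ) →ₗ[ℤ] Additive ℂˣ :=
  Fintype.linearCombination ℤ fun i => Additive.ofMul (x i)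

theorem monomialEvalLinear_apply (x : Fin n → ℂˣ) (m : Fin n → ℤ) :
    monomialEvalLinear x m = Additive.ofMul (monomialEval x m) := by
  simp [monomialEvalLinear, monomialEval, Fintype.linearCombination_apply, ofMul_prod, ofMul_zpow]

theorem monomialEvalLinear_eq_zero {x : Fin n → ℂˣ} {m : Fin n → ℤ} :
    monomialEvalLinear x m = 0 ↔ monomialEval x m = 1 := by
  rw [monomialEvalLinear_apply, ofMul_eq_zero]

theorem monomialEval_sub (x : Fin n → ℂˣ) (m m' : Fin n → ℤ) :
    monomialEval x (m - m') = monomialEval x m / monomialEval x m' := by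
  rw [← Additive.ofMul.injective.eq_iff, ofMul_div]
  simp [← monomialEvalLinear_apply]

theorem monomialEval_nsmul (x : Fin n → ℂˣ) (k : ℕ) (m : Fin n → ℤ) :
    monomialEval x (k • m) = monomialEval x m ^ k := by
  rw [← Additive.ofMul.injective.eq_iff, ofMul_pow]
  simp only [← monomialEvalLinear_apply, map_nsmul]

theorem monomialEval_eq_one_of_mem_span {x : Fin n → ℂˣ} {D : Set (Fin n → ℤ)}
    (h : ∀ d ∈ D, monomialEval x d = 1) {m : Fin n → ℤ} (hm : m ∈ Submodule.span ℤ D) :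
    monomialEval x m = 1 := by
  rw [← monomialEvalLinear_eq_zero, ← LinearMap.mem_ker]
  exact Submodule.span_le.2 (fun d hd => monomialEvalLinear_eq_zero.2 (h d hd)) hm

end monomialEval

theorem isSubtorus_of_saturated {n : ℕ} (S : Submodule ℤ (Fin n → ℤ))
    (hS : ∀ (k : ℤ) (m : Fin n → ℤ), k ≠ 0 → k • m ∈ S → m ∈ S) :
    IsSubtorus n {x | ∀ m ∈ S, monomialEval x m = 1} := by
  classical
  have : Module.IsTorsionFree ℤ ((Fin n → ℤ) ⧸ S) := by
    rw [Module.isTorsionFree_iff_smul_eq_zero]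
    intro k q hq
    obtain ⟨m, rfl⟩ := S.mkQ_surjective q
    rw [← map_smul, Submodule.mkQ_apply, Submodule.Quotient.mk_eq_zero] at hq
    by_cases hk : k = 0
    · exact Or.inl hk
    · exact Or.inr ((Submodule.Quotient.mk_eq_zero S).2 (hS k m hk hq))
  set b := Module.finBasis ℤ ((Fin n → ℤ) ⧸ S)
  choose f hf using fun j => S.mkQ_surjective (b j)
  have hrepr : ∀ m j, b.repr (S.mkQ m) j =
      ∑ i, b.repr (S.mkQ (Pi.single i 1)) j * m i := by
    intro m j
    have hm : m = ∑ i, m i • (Pi.single i 1 : Fin n → ℤ) := by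
      simp [← Pi.single_smul, Finset.univ_sum_single]
    conv_lhs => rw [hm]
    simp only [map_sum, map_smul, Finsupp.coe_finsetSum, Finset.sum_apply, Finsupp.smul_apply,
      smul_eq_mul, mul_comm]
  refine ⟨_, Matrix.of fun j i => b.repr (S.mkQ (Pi.single i 1)) j, le_antisymm ?_ ?_, ?_⟩
  · exact (Matrix.rank_le_card_height _).trans_eq (Fintype.card_fin _)
  · set E : Matrix _ (Fin n) ℤ := Matrix.of fun j i => b.repr (S.mkQ (Pi.single i 1)) j
    have hEF : E * (Matrix.of fun i j => f j i) = 1 := by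
      ext j k
      rw [Matrix.mul_apply]
      simp only [E, Matrix.of_apply]
      rw [← hrepr, hf, b.repr_self, Matrix.one_apply, Finsupp.single_apply]
      simp [eq_comm]
    have h := congrArg (fun A => Matrix.map A (Int.castRingHom ℚ)) hEF
    simp only [Matrix.map_mul, map_zero, map_one, Matrix.map_one] at h
    have hle := Matrix.rank_mul_le_left (E.map (Int.castRingHom ℚ))
      ((Matrix.of fun i j => f j i).map (Int.castRingHom ℚ))
    rw [h, Matrix.rank_one, Fintype.card_fin] at hle
    exact hle
  · ext x
    constructor
    · intro hx
      set φ := S.liftQ (monomialEvalLinear x) fun m hm => monomialEvalLinear_eq_zero.2 (hx m hm)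
      refine ⟨fun j => (φ (b j)).toMul, fun i => ?_⟩
      have h1 : φ (S.mkQ (Pi.single i 1)) = Additive.ofMul (x i) := by
        simp [φ, monomialEvalLinear]
      rw [← b.sum_repr (S.mkQ (Pi.single i 1)), map_sum] at h1
      simp only [map_smul] at h1
      rw [← Additive.ofMul.injective.eq_iff, ← h1, ofMul_prod]
      rfl
    · rintro ⟨t, ht⟩ m hm
      set φ := b.constr ℤ fun j => Additive.ofMul (t j)
      have h1 : monomialEvalLinear x = φ ∘ₗ S.mkQ := by
        refine LinearMap.pi_ext' fun i => LinearMap.ext_ring ?_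
        simp only [LinearMap.comp_apply, LinearMap.coe_single, φ, Module.Basis.constr_apply_fintype,
          monomialEvalLinear, Fintype.linearCombination_apply_single, one_smul, ht i, ofMul_prod,
          ofMul_zpow]
        rfl
      rw [← monomialEvalLinear_eq_zero, h1, LinearMap.comp_apply, Submodule.mkQ_apply,
        (Submodule.Quotient.mk_eq_zero S).2 hm, map_zero]

theorem exists_nsmul_mem_span_of_abs_det_le {n : ℕ} {D : Set (Fin n → ℤ)} {N : ℕ}
    (hdet : ∀ A : Matrix (Fin n) (Fin n) ℤ,
      (∀ i, A i ∈ D ∨ ∃ j, A i = Pi.single j 1) → |A.det| ≤ N)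
    {m : Fin n → ℤ} {k : ℤ} (hk : k ≠ 0) (hm : k • m ∈ Submodule.span ℤ D) :
    ∃ e : ℕ, 0 < e ∧ e ≤ N ∧ e • m ∈ Submodule.span ℤ D := by
  classical
  set φ : (Fin n → ℤ) →ₗ[ℤ] (Fin n → ℚ) := (Algebra.linearMap ℤ ℚ).compLeft (Fin n)
  have hφ : ∀ m i, φ m i = (m i : ℚ) := fun m i => rfl
  set std : Set (Fin n → ℤ) := Set.range fun j => Pi.single j 1
  obtain ⟨s, hsD, -, hDs, hs⟩ :=
    exists_linearIndepOn_extension (K := ℚ) (v := φ) (linearIndepOn_empty ℚ φ) (Set.empty_subset D)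
  obtain ⟨b, hbD, hsb, hspan, hb⟩ :=
    exists_linearIndepOn_extension (K := ℚ) hs (hsD.trans (Set.subset_union_left (t := std)))
  have htop : ⊤ ≤ Submodule.span ℚ (Set.range fun x : b => φ x) := by
    rw [← Set.image_eq_range, ← (Pi.basisFun ℚ (Fin n)).span_eq, Submodule.span_le]
    rintro _ ⟨j, rfl⟩
    refine hspan ⟨Pi.single j 1, Or.inr ⟨j, rfl⟩, ?_⟩
    ext i
    rw [hφ, Pi.basisFun_apply, Pi.single_apply, Pi.single_apply]
    split_ifs <;> simp
  set β := Module.Basis.mk hb htop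
  have hβ : ∀ x, β x = φ x := fun x => Module.Basis.mk_apply hb htop x
  have := Module.Finite.finite_basis β
  have := Fintype.ofFinite b
  let ε : b ≃ Fin n := Fintype.equivFinOfCardEq
    (by rw [← Module.finrank_eq_card_basis β, Module.finrank_fin_fun])
  set A : Matrix (Fin n) (Fin n) ℤ := fun i => (ε.symm i : Fin n → ℤ)
  set γ := β.reindex ε
  have hγ : ∀ i, γ i = φ (A i) := fun i => by simp [γ, hβ, A]
  have hAdet : A.det ≠ 0 := by
    have h : (A.map (Int.castRingHom ℚ)).det ≠ 0 := by
      rw [← isUnit_iff_ne_zero, ← Matrix.isUnit_iff_isUnit_det,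
        ← Matrix.linearIndependent_rows_iff_isUnit]
      have hrow : (A.map (Int.castRingHom ℚ)).row = γ := funext fun i => (hγ i).symm
      rw [hrow]
      exact γ.linearIndependent
    intro h0
    rw [← RingHom.mapMatrix_apply, ← RingHom.map_det, h0, map_zero] at h
    exact h rfl
  set u := Matrix.vecMul m A.adjugate
  have hu : ∑ i, u i • A i = A.det • m := by
    rw [← Matrix.vecMul_eq_sum, Matrix.vecMul_vecMul, Matrix.adjugate_mul, Matrix.vecMul_smul,
      Matrix.vecMul_one]
  have hmem : φ m ∈ Submodule.span ℚ (φ '' s) := by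
    have h1 : ∀ d ∈ Submodule.span ℤ D, φ d ∈ Submodule.span ℚ (φ '' s) := fun d hd => by
      have : Submodule.span ℤ D ≤ ((Submodule.span ℚ (φ '' s)).restrictScalars ℤ).comap φ :=
        Submodule.span_le.2 fun d hd => hDs ⟨d, hd, rfl⟩
      exact this hd
    have h2 := h1 _ hm
    rw [map_smul, ← Int.cast_smul_eq_zsmul ℚ] at h2
    exact (Submodule.smul_mem_iff _ (Int.cast_ne_zero.2 hk)).1 h2
  have hu0 : ∀ i, A i ∉ D → u i = 0 := fun i hi => by
    have h1 : φ (A.det • m) ∈ Submodule.span ℚ (γ '' {i | A i ∈ s}) := by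
      rw [map_smul]
      refine Submodule.smul_of_tower_mem _ _ (Submodule.span_mono ?_ hmem)
      rintro _ ⟨d, hd, rfl⟩
      refine ⟨ε ⟨d, hsb hd⟩, ?_, ?_⟩ <;> simp [hγ, A, hd]
    rw [Module.Basis.mem_span_image, ← hu, map_sum] at h1
    have h2 : ∑ i, φ (u i • A i) = ∑ i, (u i : ℚ) • γ i :=
      Finset.sum_congr rfl fun i _ => by rw [map_smul, hγ, Int.cast_smul_eq_zsmul]
    by_contra hne
    refine hi (hsD (h1 (a := i) ?_))
    rw [h2, Finset.mem_coe, Finsupp.mem_support_iff, γ.repr_sum_self]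
    exact Int.cast_ne_zero.2 hne
  refine ⟨A.det.natAbs, Int.natAbs_pos.2 hAdet, ?_, ?_⟩
  · have := hdet A fun i => (hbD (ε.symm i).2).imp id fun ⟨j, hj⟩ => ⟨j, hj.symm⟩
    rw [Int.abs_eq_natAbs] at this
    exact_mod_cast this
  · have h1 : A.det • m ∈ Submodule.span ℤ D := by
      rw [← hu]
      refine Submodule.sum_mem _ fun i _ => ?_
      by_cases hi : A i ∈ D
      · exact Submodule.smul_mem _ _ (Submodule.subset_span hi)
      · rw [hu0 i hi, zero_smul]
        exact Submodule.zero_mem _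
    rw [← natCast_zsmul]
    rcases Int.natAbs_eq A.det with h | h
    · rwa [← h]
    · rw [h, neg_smul] at h1
      exact (Submodule.neg_mem_iff _).1 h1

theorem sum_mul_eq_zero_of_minimalZeroSum {ι : Type*} {f g : ι → ℂ} (A : Finset ι)
    (hA : ∑ i ∈ A, f i = 0)
    (hg : ∀ B ⊆ A, MinimalZeroSum f B → ∀ s ∈ B, ∀ t ∈ B, g s = g t) :
    ∑ i ∈ A, f i * g i = 0 := by
  classical
  induction A using Finset.strongInduction with
  | H A ih =>
  rcases A.eq_empty_or_nonempty with rfl | hne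
  · simp
  obtain ⟨B, hBA, hB⟩ := exists_minimal_le_of_wellFoundedLT
    (fun B : Finset ι => B.Nonempty ∧ ∑ i ∈ B, f i = 0) A ⟨hne, hA⟩
  have hmin : MinimalZeroSum f B :=
    ⟨hB.1.1, hB.1.2, fun C hC hC' h0 => hC.antisymm (hB.2 ⟨hC', h0⟩ hC)⟩
  obtain ⟨s, hs⟩ := hB.1.1
  have h1 : ∑ i ∈ B, f i * g i = 0 := by
    rw [Finset.sum_congr rfl fun i hi => by rw [hg B hBA hmin i hi s hs], ← Finset.sum_mul,
      hB.1.2, zero_mul]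
  have h2 : ∑ i ∈ A \ B, f i = 0 := by
    rw [← Finset.sum_sdiff hBA, hB.1.2, add_zero] at hA
    exact hA
  rw [← Finset.sum_sdiff hBA, h1, add_zero]
  exact ih _ (Finset.sdiff_ssubset hBA hB.1.1) h2
    fun C hC => hg C (hC.trans Finset.sdiff_subset)

theorem sum_filter_eq_zero_of_forall_sum_eq_zero {G ι : Type*} [Group G] [Fintype ι]
    (f : ι → ℂ) (ψ : ι → G →* ℂ) (h : ∀ x, ∑ t, f t * ψ t x = 0) [DecidableEq (G →* ℂ)]
    (χ : G →* ℂ) : ∑ t with ψ t = χ, f t = 0 := by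
  by_cases hχ : χ ∈ Finset.univ.image ψ
  · refine linearIndependent_iff'.1 (linearIndependent_monoidHom G ℂ) (Finset.univ.image ψ)
      (fun χ => ∑ t with ψ t = χ, f t) ?_ χ hχ
    ext x
    rw [Finset.sum_apply, Pi.zero_apply, ← h x,
      ← Finset.sum_fiberwise_of_maps_to (t := Finset.univ.image ψ) (g := ψ) (by simp)]
    refine Finset.sum_congr rfl fun χ _ => ?_
    rw [Pi.smul_apply, smul_eq_mul, Finset.sum_mul]
    exact Finset.sum_congr rfl fun t ht => by rw [(Finset.mem_filter.1 ht).2]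
  · refine Finset.sum_eq_zero fun t ht => absurd ?_ hχ
    exact Finset.mem_image.2 ⟨t, Finset.mem_univ t, (Finset.mem_filter.1 ht).2⟩

theorem exists_pow_eq_unit {k : ℕ} (hk : 0 < k) (u : ℂˣ) : ∃ v : ℂˣ, v ^ k = u := by
  obtain ⟨z, hz⟩ := IsAlgClosed.exists_pow_nat_eq (u : ℂ) hk
  have hz0 : z ≠ 0 := fun h => u.ne_zero (by rw [← hz, h, zero_pow hk.ne'])
  exact ⟨Units.mk0 z hz0, Units.ext hz⟩

/-- The parametrization of the subtorus determined by an integer matrix. -/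
def torusParam {n r : ℕ} (E : Matrix (Fin r) (Fin n) ℤ) : (Fin r → ℂˣ) →* (Fin n → ℂˣ) where
  toFun t i := ∏ j, t j ^ E j i
  map_one' := by ext; simp
  map_mul' s t := by ext; simp [mul_zpow, Finset.prod_mul_distrib]

/-- A killer exponent for the hypersurface with equation `∑ t, c t * x ^ v t = 0`. -/
theorem isExponentOf_factorial_mul_factorial {n : ℕ} {ι : Type*} [Fintype ι] {c : ι → ℚ}
    {v : ι → Fin n → ℤ} {V C : Set (Fin n → ℂˣ)} {N : ℕ}
    (hV : V = {x | ∑ t, (c t : ℂ) * (monomialEval x (v t) : ℂ) = 0})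
    (hcard : Fintype.card ι ≤ N)
    (hdet : ∀ A : Matrix (Fin n) (Fin n) ℤ,
      (∀ i, (∃ s t, A i = v s - v t) ∨ ∃ j, A i = Pi.single j 1) → |A.det| ≤ N)
    (hC : IsMaximalTorsionCosetOf n C V) :
    IsExponentOf n (N.factorial * N.factorial) C := by
  classical
  obtain ⟨⟨r, ω, H, ⟨E, -, hH⟩, hω, hCω⟩, hCV, hmax⟩ := hC
  have hH' : H = Set.range (torusParam E) := by
    ext x
    simp only [hH, Set.mem_ofPred_eq, Set.mem_range, torusParam, MonoidHom.coe_mk, OneHom.coe_mk,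
      funext_iff, eq_comm]
  set f : ι → ℂ := fun t => c t * (monomialEval ω (v t) : ℂ)
  set D : Set (Fin n → ℤ) := {d | ∃ B, MinimalZeroSum f B ∧
    (∀ s ∈ B, ∀ t ∈ B, ∀ h ∈ H, monomialEval h (v s) = monomialEval h (v t)) ∧
    ∃ s ∈ B, ∃ t ∈ B, d = v s - v t}
  set L := Submodule.span ℤ D
  set S := (Submodule.torsion ℤ ((Fin n → ℤ) ⧸ L)).comap L.mkQ
  have hS : ∀ m, m ∈ S ↔ ∃ k : ℕ, 0 < k ∧ k • m ∈ L := by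
    intro m
    rw [Submodule.mem_comap, Submodule.mem_torsion_iff]
    constructor
    · rintro ⟨⟨k, hk⟩, h⟩
      have hk0 : k ≠ 0 := nonZeroDivisors.ne_zero hk
      have h' : k • m ∈ L := (Submodule.Quotient.mk_eq_zero L).1 h
      refine ⟨k.natAbs, Int.natAbs_pos.2 hk0, ?_⟩
      rw [← natCast_zsmul]
      rcases Int.natAbs_eq k with h | h
      · rwa [← h]
      · rw [h, neg_smul] at h'
        exact (Submodule.neg_mem_iff _).1 h'
    · rintro ⟨k, hk, h⟩
      refine ⟨⟨k, mem_nonZeroDivisors_of_ne_zero (by exact_mod_cast hk.ne')⟩, ?_⟩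
      rw [← natCast_zsmul] at h
      exact (Submodule.Quotient.mk_eq_zero L).2 h
  have hsat : ∀ (k : ℤ) (m : Fin n → ℤ), k ≠ 0 → k • m ∈ S → m ∈ S := by
    intro k m hk h
    obtain ⟨l, hl, h⟩ := (hS _).1 h
    refine (hS m).2 ⟨l * k.natAbs, Nat.mul_pos hl (Int.natAbs_pos.2 hk), ?_⟩
    rw [mul_smul, ← natCast_zsmul _ k.natAbs]
    rcases Int.natAbs_eq k with h' | h'
    · rwa [← h']
    · rwa [h', neg_smul, smul_neg, Submodule.neg_mem_iff] at h
  set H' : Set (Fin n → ℂˣ) := {x | ∀ m ∈ S, monomialEval x m = 1}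
  have hH'sub : IsSubtorus n H' := isSubtorus_of_saturated S hsat
  have hDS : ∀ d ∈ D, d ∈ S := fun d hd =>
    (hS d).2 ⟨1, one_pos, by rw [one_smul]; exact Submodule.subset_span hd⟩
  have hHH' : H ⊆ H' := by
    intro h hh m hm
    obtain ⟨k, hk, hkm⟩ := (hS m).1 hm
    rw [hH'] at hh
    obtain ⟨t, rfl⟩ := hh
    choose u hu using fun j => exists_pow_eq_unit hk (t j)
    have ht : t = u ^ k := funext fun j => (hu j).symm
    rw [ht, map_pow, monomialEval_pow, ← monomialEval_nsmul]
    refine monomialEval_eq_one_of_mem_span ?_ hkm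
    rintro _ ⟨B, -, hBH, s, hs, t, ht, rfl⟩
    rw [monomialEval_sub, div_eq_one]
    exact hBH s hs t ht _ (hH' ▸ ⟨u, rfl⟩)
  have hVeval : ∀ h, ω * h ∈ V ↔ ∑ t, f t * (monomialEval h (v t) : ℂ) = 0 := by
    intro h
    simp only [hV, Set.mem_ofPred_eq, monomialEval_mul, Units.val_mul, f, mul_assoc]
  set ψ : ι → (Fin r → ℂˣ) →* ℂ := fun t => (Units.coeHom ℂ).comp
    { toFun s := monomialEval (torusParam E s) (v t)
      map_one' := by simp [monomialEval]
      map_mul' a b := by rw [map_mul, monomialEval_mul] }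
  have hψ : ∀ t s, ψ t s = (monomialEval (torusParam E s) (v t) : ℂ) := fun t s => rfl
  have hfib := sum_filter_eq_zero_of_forall_sum_eq_zero f ψ fun s =>
    (hVeval (torusParam E s)).1 (hCV (by rw [hCω, hH']; exact ⟨_, ⟨s, rfl⟩, rfl⟩))
  have hH'V : (fun h => ω * h) '' H' ⊆ V := by
    rintro _ ⟨h, hh, rfl⟩
    rw [hVeval, ← Finset.sum_fiberwise_of_maps_to (t := Finset.univ.image ψ) (g := ψ) (by simp)]
    refine Finset.sum_eq_zero fun χ _ => ?_
    refine sum_mul_eq_zero_of_minimalZeroSum _ (hfib χ) fun B hB hmin s hs t ht => ?_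
    have hd : v s - v t ∈ D := by
      refine ⟨B, hmin, fun s hs t ht h hh => ?_, s, hs, t, ht, rfl⟩
      rw [hH'] at hh
      obtain ⟨u, rfl⟩ := hh
      refine Units.ext ?_
      rw [← hψ, ← hψ, (Finset.mem_filter.1 (hB hs)).2, (Finset.mem_filter.1 (hB ht)).2]
    have := hh _ (hDS _ hd)
    rw [monomialEval_sub, div_eq_one] at this
    rw [this]
  have hCH' : C = (fun h => ω * h) '' H' := by
    obtain ⟨r', hr'⟩ := hH'sub
    exact hmax _ ⟨r', ω, H', hr', hω, rfl⟩ hH'V (hCω ▸ Set.image_mono hHH')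
  refine ⟨ω, H', hH'sub, hω, hCH', fun m hm => ?_⟩
  obtain ⟨k, hk, hkm⟩ := (hS m).1 hm
  obtain ⟨e, he0, heN, hem⟩ := exists_nsmul_mem_span_of_abs_det_le (N := N) (m := m) (k := k)
    (D := D) (fun A hA => hdet A fun i => (hA i).imp
      (fun ⟨_, _, _, s, _, t, _, h⟩ => ⟨s, t, h⟩) id)
    (by exact_mod_cast hk.ne') (by rwa [natCast_zsmul])
  choose o ho hωo using hω
  have hωD : ∀ d ∈ D, monomialEval (ω ^ N.factorial) d = 1 := by
    rintro _ ⟨B, hB, -, s, hs, t, ht, rfl⟩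
    have hO : ω ^ (∏ i, o i) = 1 := funext fun i => by
      obtain ⟨q, hq⟩ := Finset.dvd_prod_of_mem o (Finset.mem_univ i)
      rw [Pi.pow_apply, hq, pow_mul, hωo, one_pow, Pi.one_apply]
    have h1 := MinimalZeroSum.pow_factorial_eq (a := c)
      (ζ := fun t => monomialEval ω (v t)) hB (k := ∏ i, o i)
      (Finset.prod_pos fun i _ => ho i)
      (fun t _ => by rw [← monomialEval_pow, hO]; simp [monomialEval]) hs ht
    obtain ⟨q, hq⟩ := Nat.factorial_dvd_factorial (B.card_le_univ.trans hcard)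
    rw [monomialEval_pow, monomialEval_sub, div_pow, div_eq_one, hq, pow_mul, h1, ← pow_mul]
  obtain ⟨q, hq⟩ := Nat.dvd_factorial he0 heN
  have h2 := monomialEval_eq_one_of_mem_span hωD hem
  rw [monomialEval_nsmul] at h2
  rw [pow_mul, monomialEval_pow]
  nth_rw 2 [hq]
  rw [pow_mul, h2, one_pow]

/-- Exponent vectors of the monomials `x₀ ^ a * ∏ i ∈ S, x i.succ`. -/
def hypersurfaceExponent {n : ℕ} (t : Fin 3 × Finset (Fin n)) : Fin (n + 1) → ℤ :=
  Fin.cons (t.1 : ℤ) fun i => if i ∈ t.2 then 1 else 0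

theorem monomialEval_hypersurfaceExponent {n : ℕ} (x : Fin (n + 1) → ℂˣ)
    (t : Fin 3 × Finset (Fin n)) :
    (monomialEval x (hypersurfaceExponent t) : ℂ) =
      (x 0 : ℂ) ^ (t.1 : ℕ) * ∏ i ∈ t.2, (x i.succ : ℂ) := by
  simp [monomialEval, hypersurfaceExponent, Fin.prod_univ_succ, Finset.prod_ite_mem, apply_ite]

/-- Coefficients of the expansion of the equation of the hypersurface into monomials. -/
def hypersurfaceCoeff {n : ℕ} (t : Fin 3 × Finset (Fin n)) : ℚ :=
  ![-(2 * ∏ _i ∈ Finset.univ \ t.2, -1),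
    -∑ j, ∏ i ∈ Finset.univ \ t.2, if i = j then 1 else -1,
    2 * ∏ _i ∈ Finset.univ \ t.2, -1] t.1

theorem hypersurface_expansion {n : ℕ} (x₀ : ℂ) (x : Fin n → ℂ) :
    2 * (x₀ ^ 2 - 1) * ∏ i, (x i - 1) - x₀ * ∑ j, (x j + 1) * ∏ i ∈ Finset.univ.erase j, (x i - 1) =
      ∑ t : Fin 3 × Finset (Fin n),
        (hypersurfaceCoeff t : ℂ) * (x₀ ^ (t.1 : ℕ) * ∏ i ∈ t.2, x i) := by
  have h1 : ∀ c : Fin n → ℂ, ∏ i, (x i + c i) =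
      ∑ S : Finset (Fin n), (∏ i ∈ S, x i) * ∏ i ∈ Finset.univ \ S, c i := fun c => by
    rw [Finset.prod_add, Finset.powerset_univ]
  have h2 : ∀ j, (x j + 1) * ∏ i ∈ Finset.univ.erase j, (x i - 1) =
      ∏ i, (x i + if i = j then 1 else -1) := fun j => by
    rw [← Finset.mul_prod_erase _ _ (Finset.mem_univ j), if_pos rfl]
    congr 1
    exact Finset.prod_congr rfl fun i hi => by
      rw [if_neg (Finset.ne_of_mem_erase hi), sub_eq_add_neg]
  simp only [h2]
  simp only [sub_eq_add_neg (x _) 1, h1, Finset.mul_sum]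
  rw [Fintype.sum_prod_type, Fin.sum_univ_three, Finset.sum_comm]
  simp only [hypersurfaceCoeff, ← Finset.sum_add_distrib, ← Finset.sum_sub_distrib]
  refine Finset.sum_congr rfl fun S _ => ?_
  simp [← Finset.mul_sum, apply_ite ((↑) : ℚ → ℂ)]
  ring

theorem Matrix.abs_det_le_factorial_mul_prod {n : ℕ} (A : Matrix (Fin n) (Fin n) ℤ) (b : Fin n → ℤ)
    (h : ∀ i j, |A i j| ≤ b j) : |A.det| ≤ n.factorial * ∏ j, b j := by
  rw [Matrix.det_apply]
  refine (Finset.abs_sum_le_sum_abs _ _).trans ?_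
  have : ∀ σ ∈ (Finset.univ : Finset (Equiv.Perm (Fin n))),
      |Equiv.Perm.sign σ • ∏ i, A (σ i) i| ≤ ∏ j, b j := fun σ _ => by
    have h1 : |Equiv.Perm.sign σ • ∏ i, A (σ i) i| = ∏ i, |A (σ i) i| := by
      rw [← Finset.abs_prod]
      rcases Int.units_eq_one_or (Equiv.Perm.sign σ) with h | h <;> simp [h]
    rw [h1]
    exact Finset.prod_le_prod (fun _ _ => abs_nonneg _) fun i _ => h _ _
  refine (Finset.sum_le_card_nsmul _ _ _ this).trans_eq ?_
  simp [Finset.card_univ, Fintype.card_perm]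

theorem abs_det_hypersurfaceExponent_le {n : ℕ} {A : Matrix (Fin (n + 1)) (Fin (n + 1)) ℤ}
    (hA : ∀ i, (∃ s t, A i = hypersurfaceExponent s - hypersurfaceExponent t) ∨
      ∃ j, A i = Pi.single j 1) : |A.det| ≤ (n + 1).factorial * 2 := by
  refine (A.abs_det_le_factorial_mul_prod (Fin.cons 2 fun _ => 1) fun i j => ?_).trans_eq ?_
  · rcases hA i with ⟨s, t, h⟩ | ⟨k, h⟩
    · rw [h]
      refine Fin.cases ?_ (fun j => ?_) j
      · have := s.1.isLt
        have := t.1.isLt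
        simp only [hypersurfaceExponent, Pi.sub_apply, Fin.cons_zero, abs_le]
        omega
      · simp only [hypersurfaceExponent, Pi.sub_apply, Fin.cons_succ]
        split_ifs <;> simp
    · rw [h, Pi.single_apply]
      refine Fin.cases ?_ (fun j => ?_) j <;> split_ifs <;> simp
  · simp [Fin.prod_univ_succ]

theorem two_pow_le_factorial_succ (n : ℕ) : 2 ^ n ≤ (n + 1).factorial := by
  induction n with
  | zero => simp
  | succ k ih =>
    rw [pow_succ', Nat.factorial_succ (k + 1)]
    exact Nat.mul_le_mul (by omega) ih

theorem eight_mul_factorial_le (n : ℕ) : 8 * (n + 2).factorial ≤ (n + 4) ^ (n + 2) := by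
  induction n with
  | zero => simp [Nat.factorial]
  | succ k ih =>
    calc 8 * (k + 1 + 2).factorial = (k + 3) * (8 * (k + 2).factorial) := by
          rw [show k + 1 + 2 = (k + 2) + 1 by ring, Nat.factorial_succ]; ring
      _ ≤ (k + 1 + 4) * (k + 1 + 4) ^ (k + 2) := Nat.mul_le_mul (by omega)
          (ih.trans (Nat.pow_le_pow_left (by omega) _))
      _ = (k + 1 + 4) ^ (k + 1 + 2) := by ring

theorem log_factorial_sq_le (N : ℕ) :
    Real.log ((N.factorial * N.factorial : ℕ) : ℝ) ≤ 4 * (N * √N) := by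
  rcases N.eq_zero_or_pos with rfl | hN
  · simp
  have hN' : (0 : ℝ) < N := Nat.cast_pos.2 hN
  have h1 : Real.log (N.factorial : ℝ) ≤ N * Real.log N := by
    rw [← Real.log_pow]
    exact Real.log_le_log (by positivity) (mod_cast Nat.factorial_le_pow N)
  have h2 : Real.log N ≤ 2 * √N := by
    have h := Real.log_le_sub_one_of_pos (Real.sqrt_pos.2 hN')
    rw [Real.log_sqrt hN'.le] at h
    linarith
  rw [Nat.cast_mul, Real.log_mul (by positivity) (by positivity)]
  nlinarith

theorem rpow_three_mul_div_two {a : ℝ} (ha : 0 ≤ a) (k : ℕ) :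
    a ^ (3 * (k : ℝ) / 2) = a ^ k * √(a ^ k) := by
  rw [Real.sqrt_eq_rpow, ← Real.rpow_natCast, ← Real.rpow_mul ha,
    ← Real.rpow_add_of_nonneg ha (by positivity) (by positivity)]
  congr 1
  ring

theorem three_mul_factorial_lt (n : ℕ) :
    ((3 * (n + 1).factorial : ℕ) : ℝ) < ((n : ℝ) + 3) ^ (3 * ((n : ℝ) + 1) / 2) := by
  have h := rpow_three_mul_div_two (a := (n : ℝ) + 3) (by positivity) (n + 1)
  push_cast at h
  rw [h]
  rcases n with _ | n
  · have : 1 < √(3 : ℝ) := Real.lt_sqrt_of_sq_lt (by norm_num)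
    norm_num
    exact this
  · have h1 : (8 * (n + 2).factorial : ℝ) ≤ (n + 4) ^ (n + 2) := mod_cast eight_mul_factorial_le n
    have h2 : (0 : ℝ) < (n + 2).factorial := by positivity
    push_cast
    rw [show (n : ℝ) + 1 + 3 = n + 4 by ring, show n + 1 + 1 = n + 2 by ring]
    have h3 : 1 ≤ √(((n : ℝ) + 4) ^ (n + 2)) :=
      Real.one_le_sqrt.2 (one_le_pow₀ (by linarith [n.cast_nonneg (α := ℝ)]))
    nlinarith

theorem log_killer_le (n : ℕ) :
    Real.log (((3 * (n + 1).factorial).factorial * (3 * (n + 1).factorial).factorial : ℕ) : ℝ) ≤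
      ((n : ℝ) + 3) ^ (3 * ((n : ℝ) + 1) / 2) := by
  have h := rpow_three_mul_div_two (a := (n : ℝ) + 3) (by positivity) (n + 1)
  push_cast at h
  rw [h]
  rcases n with _ | n
  · have h1 : (5 / 3 : ℝ) ≤ √3 := Real.le_sqrt_of_sq_le (by norm_num)
    have h2 : Real.log 36 ≤ 5 := by
      rw [Real.log_le_iff_le_exp (by norm_num), ← Real.exp_one_rpow]
      have := Real.exp_one_gt_d9
      calc (36 : ℝ) ≤ 2.7 ^ (5 : ℝ) := by norm_num
        _ ≤ Real.exp 1 ^ (5 : ℝ) := Real.rpow_le_rpow (by norm_num) (by linarith) (by norm_num)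
    norm_num [Nat.factorial]
    linarith
  · refine (log_factorial_sq_le _).trans ?_
    have h1 : (8 * (n + 2).factorial : ℝ) ≤ (n + 4) ^ (n + 2) := mod_cast eight_mul_factorial_le n
    push_cast
    rw [show (n : ℝ) + 1 + 3 = n + 4 by ring, show n + 1 + 1 = n + 2 by ring]
    set X : ℝ := (n + 4) ^ (n + 2)
    have hX : 0 ≤ X := by positivity
    have h2 : (3 * (n + 2).factorial : ℝ) ≤ 3 / 8 * X := by linarith
    have h3 : √(3 * (n + 2).factorial : ℝ) ≤ 5 / 8 * √X := by
      rw [show (5 / 8 : ℝ) * √X = √((5 / 8) ^ 2 * X) by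
        rw [Real.sqrt_mul (by positivity), Real.sqrt_sq (by norm_num)]]
      exact Real.sqrt_le_sqrt (by nlinarith)
    calc 4 * (3 * (n + 2).factorial * √(3 * (n + 2).factorial : ℝ))
        ≤ 4 * (3 / 8 * X * (5 / 8 * √X)) := by gcongr
      _ ≤ X * √X := by nlinarith [mul_nonneg hX (Real.sqrt_nonneg X)]

/-- For the hypersurface
`h = 2(x₀² - 1) ∏_{i=1}^n (x_i - 1) - x₀ Σ_{j=1}^n (x_j + 1) ∏_{i ≠ j} (x_i - 1) = 0`
in `G_m^(n+1)`, there is a killer exponent `K` — an exponent of every maximal torsion coset —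
with `log log K < 0.2 + (3(n+1)/2) log(n+3)`, which moreover can be chosen with all its prime
factors less than `(n+3)^(3(n+1)/2)`. -/
theorem killer_exponent_of_hypersurface (n : ℕ) (V : Set (Fin (n + 1) → ℂˣ))
    (hV : V = { x | 2 * ((x 0 : ℂ) ^ 2 - 1) * ∏ i : Fin n, ((x i.succ : ℂ) - 1)
        - (x 0 : ℂ) * ∑ j : Fin n, ((x j.succ : ℂ) + 1)
            * ∏ i ∈ Finset.univ.erase j, ((x i.succ : ℂ) - 1) = 0 }) :
    ∃ K : ℕ, 0 < K ∧
      (∀ C : Set (Fin (n + 1) → ℂˣ), IsMaximalTorsionCosetOf (n + 1) C V →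
        IsExponentOf (n + 1) K C) ∧
      Real.log (Real.log K) < 0.2 + (3 * ((n : ℝ) + 1) / 2) * Real.log ((n : ℝ) + 3) ∧
      (∀ p : ℕ, p.Prime → p ∣ K → (p : ℝ) < ((n : ℝ) + 3) ^ (3 * ((n : ℝ) + 1) / 2)) := by
  set N := 3 * (n + 1).factorial
  have hN : 3 ≤ N := Nat.le_mul_of_pos_right _ (Nat.factorial_pos _)
  refine ⟨N.factorial * N.factorial, by positivity, fun C hC => ?_, ?_, fun p hp hpK => ?_⟩
  · refine isExponentOf_factorial_mul_factorial (c := hypersurfaceCoeff)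
      (v := hypersurfaceExponent) ?_ ?_ (fun A hA => ?_) hC
    · simp only [hV, hypersurface_expansion, monomialEval_hypersurfaceExponent]
    · simpa [N] using two_pow_le_factorial_succ n
    · refine (abs_det_hypersurfaceExponent_le hA).trans ?_
      have := Nat.factorial_pos (n + 1)
      push_cast [N]
      omega
  · have h1 : (1 : ℝ) < ((N.factorial * N.factorial : ℕ) : ℝ) := by
      have h6 : (3).factorial ≤ N.factorial := Nat.factorial_le hN
      have : 1 < N.factorial * N.factorial := by
        simp only [Nat.factorial] at h6
        nlinarith
      exact_mod_cast this
    have h2 := Real.log_le_log (Real.log_pos h1) (log_killer_le n)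
    rw [Real.log_rpow (by positivity)] at h2
    linarith
  · have hpN : p ≤ N := by
      rcases hp.dvd_mul.1 hpK with h | h <;> exact hp.dvd_factorial.1 h
    exact (Nat.cast_le.2 hpN).trans_lt (three_mul_factorial_lt n)
end
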